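/- Let q = p^e ≥ 7 be a prime power with p prime and q ≠ 9, and set d = gcd(2, q−1). Then PSL₂(q) admits an unmixed Beauville structure of type (((q−1)/d, (q−1)/d, p), ((q+1)/d, (q+1)/d, (q+1)/d)). -/

import Mathlib

open Matrix

/-- The projective special linear group `PSL₂(F) = SL(2, F) / Z(SL(2, F))`. -/
abbrev PSL2 (F : Type*) [Field F] :=
  Matrix.SpecialLinearGroup (Fin 2) F ⧸ Subgroup.center (Matrix.SpecialLinearGroup (Fin 2) F)

/-- `Σ(a)`: the union of the conjugacy classes of all powers of `a`. -/
def conjPowers {G : Type*} [Group G] (a : G) : Set G :=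
  {x | ∃ (g : G) (j : ℕ), x = g * a ^ j * g⁻¹}

/-- `Σ(a, b, c)`: the union of the conjugacy classes of all powers of `a`, of `b`, and
of `c`. -/
def sigma3 {G : Type*} [Group G] (a b c : G) : Set G :=
  conjPowers a ∪ conjPowers b ∪ conjPowers c

/-- An unmixed Beauville structure for a group `G`: two triples, each with product `1` and
generating `G`, whose `Σ`-sets intersect trivially. -/
def IsUnmixedBeauville {G : Type*} [Group G] (a₁ b₁ c₁ a₂ b₂ c₂ : G) : Prop :=
  a₁ * b₁ * c₁ = 1 ∧ a₂ * b₂ * c₂ = 1 ∧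
  Subgroup.closure ({a₁, b₁} : Set G) = ⊤ ∧ Subgroup.closure ({a₂, b₂} : Set G) = ⊤ ∧
  sigma3 a₁ b₁ c₁ ∩ sigma3 a₂ b₂ c₂ = {1}

/-- `G` admits an unmixed Beauville structure of type `((r₁,s₁,t₁),(r₂,s₂,t₂))`. -/
def HasBeauvilleOfType (G : Type*) [Group G] (r₁ s₁ t₁ r₂ s₂ t₂ : ℕ) : Prop :=
  ∃ a₁ b₁ c₁ a₂ b₂ c₂ : G, IsUnmixedBeauville a₁ b₁ c₁ a₂ b₂ c₂ ∧
    orderOf a₁ = r₁ ∧ orderOf b₁ = s₁ ∧ orderOf c₁ = t₁ ∧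
    orderOf a₂ = r₂ ∧ orderOf b₂ = s₂ ∧ orderOf c₂ = t₂

open scoped MatrixGroups

section FieldLemmas

lemma card_filter_quadratic_le_two {F : Type*} [Field F] (a b c : F) (h : a ≠ 0 ∨ b ≠ 0) (s : Finset F)
    (hs : ∀ x ∈ s, a * x ^ 2 + b * x + c = 0) : s.card ≤ 2 := by
  by_contra! hlt
  obtain ⟨x, hx, y, hy, z, hz, hxy, hxz, hyz⟩ := Finset.two_lt_card.1 hlt
  have ex := hs x hx
  have ey := hs y hy
  have ez := hs z hz
  have h1 : a * (x + y) + b = 0 := by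
    apply mul_left_cancel₀ (sub_ne_zero.2 hxy)
    linear_combination ex - ey
  have h2 : a * (x + z) + b = 0 := by
    apply mul_left_cancel₀ (sub_ne_zero.2 hxz)
    linear_combination ex - ez
  have ha : a = 0 := by
    apply mul_left_cancel₀ (sub_ne_zero.2 hyz)
    linear_combination h1 - h2
  subst ha
  simp at h1
  simp_all

variable {F : Type*} [Field F] [Fintype F]

lemma Subring.inv_mem_of_fintype (k : Subring F) {r : F} (hr : r ∈ k) : r⁻¹ ∈ k := by
  rcases eq_or_ne r 0 with rfl | h0
  · simp
  · have h : r⁻¹ = r ^ (Fintype.card F - 1 - 1) := by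
      have h1 := FiniteField.pow_card_sub_one_eq_one r h0
      have h2 : 1 ≤ Fintype.card F - 1 := by
        have := Fintype.one_lt_card (α := F)
        omega
      rw [inv_eq_iff_eq_inv, eq_comm, inv_eq_iff_eq_inv, eq_comm, inv_eq_of_mul_eq_one_left]
      rw [← pow_succ, Nat.sub_add_cancel h2, h1]
    rw [h]
    exact k.pow_mem hr _

lemma Subring.div_mem_of_fintype (k : Subring F) {r t : F} (hr : r ∈ k) (ht : t ∈ k) :
    r / t ∈ k := by
  rw [div_eq_mul_inv]
  exact k.mul_mem hr (k.inv_mem_of_fintype ht)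

lemma Subring.card_sq_le_of_ne_top (k : Subring F) (hk : k ≠ ⊤) :
    Nat.card k * Nat.card k ≤ Fintype.card F := by
  obtain ⟨x, hx⟩ : ∃ x, x ∉ k := by
    by_contra! h
    exact hk (eq_top_iff.2 fun y _ ↦ h y)
  rw [← Nat.card_prod, ← Nat.card_eq_fintype_card]
  refine Nat.card_le_card_of_injective (fun ab : k × k ↦ (ab.1 : F) + ab.2 * x) ?_
  rintro ⟨⟨a, ha⟩, ⟨b, hb⟩⟩ ⟨⟨c, hc⟩, ⟨d, hd⟩⟩ h
  simp only at h
  by_cases hbd : b = d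
  · subst hbd
    have : a = c := by linear_combination h
    subst this
    rfl
  · refine absurd ?_ hx
    have h1 : b - d ≠ 0 := sub_ne_zero.2 hbd
    have : x = (c - a) / (b - d) := by
      rw [eq_div_iff h1]
      linear_combination h
    rw [this]
    exact k.div_mem_of_fintype (k.sub_mem hc ha) (k.sub_mem hb hd)

lemma isSquare_div_of_quadraticChar_eq [DecidableEq F] {a b : F} (ha : a ≠ 0) (hb : b ≠ 0)
    (h : quadraticChar F a = quadraticChar F b) : ∃ t, a = t ^ 2 * b := by
  have hab : quadraticChar F (a / b) = 1 := by
    have h1 : quadraticChar F (a / b) * quadraticChar F b = quadraticChar F a := by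
      rw [← map_mul, div_mul_cancel₀ _ hb]
    rw [h] at h1
    have h2 : quadraticChar F b ≠ 0 := by
      rwa [Ne, quadraticChar_eq_zero_iff]
    exact mul_right_cancel₀ h2 (by rw [h1, one_mul])
  obtain ⟨t, ht⟩ := (quadraticChar_one_iff_isSquare (div_ne_zero ha hb)).1 hab
  exact ⟨t, by rw [sq, ← ht, div_mul_cancel₀ _ hb]⟩

/-- In odd characteristic a separable monic quadratic takes at least `(q - 3) / 2` nonzero square
values. -/
lemma card_square_values_quadratic (h2 : (2 : F) ≠ 0) (β γ : F) (hd : β ^ 2 - 4 * γ ≠ 0)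
    (R : Finset F) (hR : ∀ ρ y, (ρ ^ 2 + β * ρ + γ) * y ^ 2 = 1 → ρ ∈ R) :
    Fintype.card F ≤ 2 * R.card + 3 := by
  classical
  have h4 : (4 : F) ≠ 0 := by
    rw [show (4 : F) = 2 * 2 by norm_num]
    exact mul_ne_zero h2 h2
  set D := (β ^ 2 - 4 * γ) / 4 with hD
  have hD0 : D ≠ 0 := div_ne_zero hd h4
  set S : Finset F := Finset.univ.filter fun u ↦ u ≠ 0 ∧ u ^ 2 ≠ D with hS
  have hcompl : Fintype.card F ≤ S.card + 3 := by
    have hsub : (Finset.univ : Finset F) ⊆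
        ({0} ∪ Finset.univ.filter fun u : F ↦ u ^ 2 = D) ∪ S := by
      intro u _
      simp only [hS, Finset.mem_filter, Finset.mem_univ, true_and, Finset.mem_union,
        Finset.mem_singleton]
      tauto
    have h3 : (Finset.univ.filter fun u : F ↦ u ^ 2 = D).card ≤ 2 :=
      card_filter_quadratic_le_two 1 0 (-D) (Or.inl one_ne_zero) _ (by
        intro x hx
        simp only [Finset.mem_filter, Finset.mem_univ, true_and] at hx
        linear_combination hx)
    have h5 := Finset.card_le_card hsub
    have h6 := Finset.card_union_le ({0} ∪ Finset.univ.filter fun u : F ↦ u ^ 2 = D) S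
    have h7 := Finset.card_union_le {0} (Finset.univ.filter fun u : F ↦ u ^ 2 = D)
    rw [Finset.card_univ] at h5
    rw [Finset.card_singleton] at h7
    omega
  have himg : S.card ≤ 2 * (S.image fun u ↦ (u + D / u - β) / 2).card := by
    refine Finset.card_le_mul_card_image _ _ fun b _ ↦ ?_
    refine card_filter_quadratic_le_two 1 (-(2 * b + β)) D (Or.inl one_ne_zero) _ ?_
    intro x hx
    simp only [Finset.mem_filter, hS, Finset.mem_univ, true_and] at hx
    obtain ⟨⟨hx0, _⟩, hx⟩ := hx
    rw [← hx]
    field_simp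
    ring
  have hsub : (S.image fun u ↦ (u + D / u - β) / 2) ⊆ R := by
    intro ρ hρ
    simp only [Finset.mem_image, hS, Finset.mem_filter, Finset.mem_univ, true_and] at hρ
    obtain ⟨u, ⟨hu0, huD⟩, rfl⟩ := hρ
    have hne : u ^ 2 - D ≠ 0 := sub_ne_zero.2 huD
    refine hR _ (2 * u / (u ^ 2 - D)) ?_
    have hγ : γ = β ^ 2 / 4 - D := by
      rw [hD]
      field_simp
      ring
    rw [hγ]
    field_simp
    ring
  have := Finset.card_le_card hsub
  omega

end FieldLemmas

section FieldLemmas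

variable {F : Type*} [Field F] [Fintype F]

/-- If a quadratic sequence takes values in a fixed multiple of a subfield at three
points, then the ratio of its coefficients lies in the subfield. -/
lemma Subring.coeff_ratio_mem (k : Subring F) {X Y μ : F} (hμ : μ ≠ 0)
    (a b c : ℤ) (hab : ((a - b : ℤ) : F) ≠ 0) (hac : ((a - c : ℤ) : F) ≠ 0)
    (hbc : ((b - c : ℤ) : F) ≠ 0)
    (ha : (1 + a * X + a ^ 2 * Y) / μ ∈ k) (hb : (1 + b * X + b ^ 2 * Y) / μ ∈ k)
    (hc : (1 + c * X + c ^ 2 * Y) / μ ∈ k) : X / Y ∈ k := by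
  have i1 : (((a - b : ℤ) : F))⁻¹ ∈ k := k.inv_mem_of_fintype (intCast_mem k _)
  have i2 : (((a - c : ℤ) : F))⁻¹ ∈ k := k.inv_mem_of_fintype (intCast_mem k _)
  have i3 : (((b - c : ℤ) : F))⁻¹ ∈ k := k.inv_mem_of_fintype (intCast_mem k _)
  have d1 : (X + (a + b) * Y) / μ ∈ k := by
    convert k.mul_mem (k.sub_mem ha hb) i1 using 1
    push_cast at *
    field_simp
    ring
  have d2 : (X + (a + c) * Y) / μ ∈ k := by
    convert k.mul_mem (k.sub_mem ha hc) i2 using 1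
    push_cast at *
    field_simp
    ring
  have d3 : Y / μ ∈ k := by
    convert k.mul_mem (k.sub_mem d1 d2) i3 using 1
    push_cast at *
    field_simp
    ring
  have d4 : X / μ ∈ k := by
    have h : ((a + b : ℤ) : F) ∈ k := intCast_mem k _
    convert k.sub_mem d1 (k.mul_mem h d3) using 1
    push_cast
    ring
  have := k.div_mem_of_fintype d4 d3
  rwa [div_div_div_cancel_right₀ hμ] at this

variable {k : Subring F} {β γ s : F} {M : Set F}

lemma multiplier_eq_top_of_char_two (hs : s ≠ 0) (h2 : (2 : F) = 0)
    (hsβ : s ≠ β)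
    (hMk : ∀ m ∈ M, ∀ m' ∈ M, ∀ a, m = a ^ 2 * m' → a ^ 2 ∈ k)
    (hM : ∀ ρ y, (ρ ^ 2 + β * ρ + γ) * y ^ 2 = 1 →
      ∀ n : ℤ, ((ρ + n * s) ^ 2 + β * (ρ + n * s) + γ) * y ^ 2 ∈ M)
    (hq : 7 ≤ Fintype.card F) : k = ⊤ := by
  classical
  by_contra hk
  have hcard := k.card_sq_le_of_ne_top hk
  have hsq : ∀ a : F, IsSquare a := FiniteField.isSquare_of_char_two
    ((CharP.ringChar_of_prime_eq_zero Nat.prime_two (by exact_mod_cast h2)))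
  set c := s * β + s ^ 2 with hc
  have hc0 : c ≠ 0 := by
    rw [hc, show s * β + s ^ 2 = s * (s - β) by linear_combination (s * β) * h2]
    exact mul_ne_zero hs (sub_ne_zero.2 hsβ)
  have key : ∀ ρ, ρ ^ 2 + β * ρ + γ ≠ 0 → (ρ ^ 2 + β * ρ + γ) / c ∈ k := by
    intro ρ hρ
    obtain ⟨t, ht⟩ := hsq (ρ ^ 2 + β * ρ + γ)
    have ht0 : t ≠ 0 := by
      rintro rfl
      simp at ht
      exact hρ ht
    have e0 : (ρ ^ 2 + β * ρ + γ) * t⁻¹ ^ 2 = 1 := by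
      rw [ht]
      field_simp
    have m0 := hM ρ t⁻¹ e0 0
    have m1 := hM ρ t⁻¹ e0 1
    obtain ⟨u, hu⟩ := hsq (((ρ + (1 : ℤ) * s) ^ 2 + β * (ρ + (1 : ℤ) * s) + γ) * t⁻¹ ^ 2)
    have hu2 : u ^ 2 ∈ k := by
      refine hMk _ m1 _ m0 u ?_
      simp only [Int.cast_zero, zero_mul, add_zero, e0]
      rw [hu]
      ring
    have h3 : u ^ 2 - 1 = c * t⁻¹ ^ 2 := by
      rw [sq u, ← hu, ← e0, hc]
      push_cast
      linear_combination (ρ * s * t⁻¹ ^ 2) * h2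
    have h4 : (ρ ^ 2 + β * ρ + γ) / c = (u ^ 2 - 1)⁻¹ := by
      rw [h3, ht]
      field_simp
    rw [h4]
    exact k.inv_mem_of_fintype (k.sub_mem hu2 k.one_mem)
  set R : Finset F := Finset.univ.filter fun ρ ↦ ρ ^ 2 + β * ρ + γ ≠ 0 with hR
  have hRcard : Fintype.card F ≤ R.card + 2 := by
    have hsub : (Finset.univ : Finset F) ⊆
        R ∪ Finset.univ.filter fun ρ : F ↦ ρ ^ 2 + β * ρ + γ = 0 := by
      intro u _
      simp only [hR, Finset.mem_filter, Finset.mem_univ, true_and, Finset.mem_union]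
      tauto
    have h3 : (Finset.univ.filter fun ρ : F ↦ ρ ^ 2 + β * ρ + γ = 0).card ≤ 2 :=
      card_filter_quadratic_le_two 1 β γ (Or.inl one_ne_zero) _ (by
        intro x hx
        simp only [Finset.mem_filter, Finset.mem_univ, true_and] at hx
        linear_combination hx)
    have h5 := Finset.card_le_card hsub
    have h6 := Finset.card_union_le R (Finset.univ.filter fun ρ : F ↦ ρ ^ 2 + β * ρ + γ = 0)
    rw [Finset.card_univ] at h5
    omega
  have himg : R.card ≤ 2 * (R.image fun ρ ↦ (ρ ^ 2 + β * ρ + γ) / c).card := by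
    refine Finset.card_le_mul_card_image _ _ fun b _ ↦ ?_
    refine card_filter_quadratic_le_two 1 β (γ - b * c) (Or.inl one_ne_zero) _ ?_
    intro x hx
    simp only [Finset.mem_filter] at hx
    rw [← hx.2]
    field_simp
    ring
  have hk2 : (R.image fun ρ ↦ (ρ ^ 2 + β * ρ + γ) / c).card ≤ Nat.card k := by
    rw [← Nat.card_eq_finsetCard]
    refine Nat.card_le_card_of_injective (fun x ↦ ⟨x.1, ?_⟩) ?_
    · obtain ⟨ρ, hρ, h⟩ := Finset.mem_image.1 x.2
      rw [← h]
      exact key ρ (Finset.mem_filter.1 hρ).2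
    · rintro ⟨x, hx⟩ ⟨y, hy⟩ h
      simpa using h
  have : Nat.card k ≤ 2 := by nlinarith
  nlinarith

lemma quadratic_sequence_value {F : Type*} [Field F] {β γ s ρ y : F} (h : (ρ ^ 2 + β * ρ + γ) * y ^ 2 = 1) (n : F) :
    ((ρ + n * s) ^ 2 + β * (ρ + n * s) + γ) * y ^ 2 =
      1 + n * ((2 * ρ + β) * s * y ^ 2) + n ^ 2 * (s ^ 2 * y ^ 2) := by
  linear_combination h

lemma multiplier_eq_top_of_five_le (hd : β ^ 2 - 4 * γ ≠ 0) (hs : s ≠ 0) (h2 : (2 : F) ≠ 0)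
    (h3 : (3 : F) ≠ 0) (hM0 : ∀ m ∈ M, m ≠ 0)
    (hMk : ∀ m ∈ M, ∀ m' ∈ M, ∀ a, m = a ^ 2 * m' → a ^ 2 ∈ k)
    (hM : ∀ ρ y, (ρ ^ 2 + β * ρ + γ) * y ^ 2 = 1 →
      ∀ n : ℤ, ((ρ + n * s) ^ 2 + β * (ρ + n * s) + γ) * y ^ 2 ∈ M)
    (hq : 7 ≤ Fintype.card F) : k = ⊤ := by
  classical
  by_contra hk
  have hcard := k.card_sq_le_of_ne_top hk
  have h4 : (4 : F) ≠ 0 := by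
    rw [show (4 : F) = 2 * 2 by norm_num]
    exact mul_ne_zero h2 h2
  set S : Finset ℤ := {-2, -1, 0, 1, 2} with hS
  have hcast : ∀ a ∈ S, ∀ b ∈ S, a ≠ b → ((a - b : ℤ) : F) ≠ 0 := by
    intro a ha b hb hab
    have hd : (a - b = 1 ∨ a - b = 2 ∨ a - b = 3 ∨ a - b = 4) ∨
        (a - b = -1 ∨ a - b = -2 ∨ a - b = -3 ∨ a - b = -4) := by
      simp only [hS, Finset.mem_insert, Finset.mem_singleton] at ha hb
      omega
    rcases hd with (h | h | h | h) | (h | h | h | h) <;> rw [h] <;> push_cast <;>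
      simp [h2, h3, h4]
  have key : ∀ ρ y, (ρ ^ 2 + β * ρ + γ) * y ^ 2 = 1 → (2 * ρ + β) / s ∈ k := by
    intro ρ y hρ
    have hy : y ≠ 0 := by
      rintro rfl
      simp at hρ
    set m : ℤ → F := fun n ↦ ((ρ + n * s) ^ 2 + β * (ρ + n * s) + γ) * y ^ 2 with hm
    have hmM : ∀ n, m n ∈ M := fun n ↦ hM ρ y hρ n
    have hm0 : ∀ n, m n ≠ 0 := fun n ↦ hM0 _ (hmM n)
    obtain ⟨ε, -, hε⟩ := Finset.exists_lt_card_fiber_of_mul_lt_card_of_maps_to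
      (s := S) (t := ({1, -1} : Finset ℤ)) (n := 2) (f := fun n ↦ quadraticChar F (m n))
      (by
        intro n _
        rcases quadraticChar_dichotomy (hm0 n) with h | h <;> simp [h])
      (by decide)
    obtain ⟨a, ha, b, hb, c, hc, hab, hac, hbc⟩ := Finset.two_lt_card.1 hε
    rw [Finset.mem_filter] at ha hb hc
    have hin : ∀ n, quadraticChar F (m n) = ε → m n / m c ∈ k := by
      intro n hn
      obtain ⟨t, ht⟩ := isSquare_div_of_quadraticChar_eq (hm0 n) (hm0 c) (hn.trans hc.2.symm)
      have := hMk _ (hmM n) _ (hmM c) t ht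
      rwa [ht, mul_div_cancel_right₀ _ (hm0 c)]
    have ea : m a = _ := quadratic_sequence_value hρ a
    have eb : m b = _ := quadratic_sequence_value hρ b
    have ec : m c = _ := quadratic_sequence_value hρ c
    have ha' := hin a ha.2
    have hb' := hin b hb.2
    have hc' := hin c hc.2
    rw [ea] at ha'
    rw [eb] at hb'
    nth_rewrite 1 [ec] at hc'
    have := k.coeff_ratio_mem (hm0 c) a b c (hcast _ ha.1 _ hb.1 hab) (hcast _ ha.1 _ hc.1 hac)
      (hcast _ hb.1 _ hc.1 hbc) ha' hb' hc'
    convert this using 1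
    field_simp
  set R : Finset F := Finset.univ.filter fun ρ ↦ ∃ y, (ρ ^ 2 + β * ρ + γ) * y ^ 2 = 1 with hR
  have hRcard := card_square_values_quadratic h2 β γ hd R
    (fun ρ y h ↦ Finset.mem_filter.2 ⟨Finset.mem_univ _, y, h⟩)
  have hRk : R.card ≤ Nat.card k := by
    rw [← Nat.card_eq_finsetCard]
    refine Nat.card_le_card_of_injective (fun x ↦ ⟨(2 * x.1 + β) / s, ?_⟩) ?_
    · obtain ⟨y, hy⟩ := (Finset.mem_filter.1 x.2).2
      exact key _ y hy
    · rintro ⟨x, hx⟩ ⟨y, hy⟩ h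
      simp only [Subtype.mk.injEq] at h ⊢
      field_simp at h
      exact mul_left_cancel₀ h2 (by linear_combination h)
  have h5 : 5 ≤ Nat.card k := by
    have : S.card ≤ Nat.card k := by
      rw [← Nat.card_eq_finsetCard]
      refine Nat.card_le_card_of_injective (fun x ↦ ⟨((x.1 : ℤ) : F), intCast_mem k _⟩) ?_
      rintro ⟨x, hx⟩ ⟨y, hy⟩ h
      simp only [Subtype.mk.injEq] at h ⊢
      by_contra hne
      exact hcast x hx y hy hne (by push_cast; linear_combination h)
    simpa [hS] using this
  nlinarith

lemma multiplier_eq_top_of_char_three (hd : β ^ 2 - 4 * γ ≠ 0) (hs : s ≠ 0) (h2 : (2 : F) ≠ 0)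
    (h3 : (3 : F) = 0) (hM0 : ∀ m ∈ M, m ≠ 0)
    (hMk : ∀ m ∈ M, ∀ m' ∈ M, ∀ a, m = a ^ 2 * m' → a ^ 2 ∈ k)
    (hM : ∀ ρ y, (ρ ^ 2 + β * ρ + γ) * y ^ 2 = 1 →
      ∀ n : ℤ, ((ρ + n * s) ^ 2 + β * (ρ + n * s) + γ) * y ^ 2 ∈ M)
    (hq : 7 ≤ Fintype.card F) (hq9 : Fintype.card F ≠ 9) : k = ⊤ := by
  classical
  by_contra hk
  have hcard := k.card_sq_le_of_ne_top hk
  set R : Finset F := Finset.univ.filter fun ρ ↦ ∃ y, (ρ ^ 2 + β * ρ + γ) * y ^ 2 = 1 with hR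
  have hRcard := card_square_values_quadratic h2 β γ hd R
    (fun ρ y h ↦ Finset.mem_filter.2 ⟨Finset.mem_univ _, y, h⟩)
  set f : F → F := fun ρ ↦ ((ρ + s) ^ 2 + β * (ρ + s) + γ) / (ρ ^ 2 + β * ρ + γ) with hf
  have hfM : ∀ ρ ∈ R, f ρ ∈ M := by
    intro ρ hρ
    obtain ⟨y, hy⟩ := (Finset.mem_filter.1 hρ).2
    convert hM ρ y hy 1 using 1
    rw [hf]
    simp only [Int.cast_one, one_mul]
    rw [div_eq_mul_inv, inv_eq_of_mul_eq_one_right hy]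
  have hP0 : ∀ ρ ∈ R, ρ ^ 2 + β * ρ + γ ≠ 0 := by
    intro ρ hρ h0
    obtain ⟨y, hy⟩ := (Finset.mem_filter.1 hρ).2
    simp [h0] at hy
  have himg : R.card ≤ 2 * (R.image f).card := by
    refine Finset.card_le_mul_card_image _ _ fun c _ ↦ ?_
    refine card_filter_quadratic_le_two (1 - c) (2 * s + β * (1 - c))
      (s ^ 2 + β * s + γ * (1 - c)) ?_ _ ?_
    · by_cases hc : c = 1
      · right
        simp [hc, hs, h2]
      · left
        exact sub_ne_zero.2 (Ne.symm hc)
    · intro x hx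
      rw [Finset.mem_filter] at hx
      have h0 := hP0 x hx.1
      have h := hx.2
      simp only [hf] at h
      rw [div_eq_iff h0] at h
      linear_combination h
  have hin : ∀ ε : ℤ,
      ((R.image f).filter fun m ↦ quadraticChar F m = ε).card + 1 ≤ Nat.card k := by
    intro ε
    rcases Finset.eq_empty_or_nonempty
      ((R.image f).filter fun m ↦ quadraticChar F m = ε) with he | ⟨μ, hμ⟩
    · rw [he, Finset.card_empty]
      have : 0 < Nat.card k := Nat.card_pos
      omega
    · rw [← Nat.card_eq_finsetCard]
      have hM' : ∀ x ∈ (R.image f).filter fun m ↦ quadraticChar F m = ε,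
          x ∈ M ∧ quadraticChar F x = ε := by
        intro x hx
        rw [Finset.mem_filter, Finset.mem_image] at hx
        obtain ⟨⟨ρ, hρ, rfl⟩, h⟩ := hx
        exact ⟨hfM ρ hρ, h⟩
      rw [← Finite.card_option]
      have hdiv : ∀ x ∈ (R.image f).filter fun m ↦ quadraticChar F m = ε, x / μ ∈ k := by
        intro x hx
        obtain ⟨hx1, hx2⟩ := hM' x hx
        obtain ⟨hμ1, hμ2⟩ := hM' μ hμ
        obtain ⟨t, ht⟩ := isSquare_div_of_quadraticChar_eq (hM0 _ hx1) (hM0 _ hμ1)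
          (hx2.trans hμ2.symm)
        have := hMk _ hx1 _ hμ1 t ht
        rwa [ht, mul_div_cancel_right₀ _ (hM0 _ hμ1)]
      have hμ0 := hM0 _ (hM' μ hμ).1
      refine Nat.card_le_card_of_injective (fun o ↦ match o with
        | none => (0 : k)
        | some x => ⟨x.1 / μ, hdiv _ x.2⟩) ?_
      rintro (_ | ⟨x, hx⟩) (_ | ⟨y, hy⟩) h
      · rfl
      · have := hM0 _ (hM' y hy).1
        simp only [Subtype.ext_iff, ZeroMemClass.coe_zero] at h
        exact absurd h.symm (div_ne_zero this hμ0)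
      · have := hM0 _ (hM' x hx).1
        simp only [Subtype.ext_iff, ZeroMemClass.coe_zero] at h
        exact absurd h (div_ne_zero this hμ0)
      · simp only [Subtype.mk.injEq] at h
        rw [div_left_inj' hμ0] at h
        subst h
        rfl
  have hC : (R.image f).card + 2 ≤ 2 * Nat.card k := by
    have hsub : R.image f ⊆ ((R.image f).filter fun m ↦ quadraticChar F m = 1) ∪
        ((R.image f).filter fun m ↦ quadraticChar F m = -1) := by
      intro x hx
      rw [Finset.mem_union, Finset.mem_filter, Finset.mem_filter]
      obtain ⟨ρ, hρ, rfl⟩ := Finset.mem_image.1 hx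
      rcases quadraticChar_dichotomy (hM0 _ (hfM ρ hρ)) with h | h
      · exact Or.inl ⟨hx, h⟩
      · exact Or.inr ⟨hx, h⟩
    have h5 := Finset.card_le_card hsub
    have h6 := Finset.card_union_le ((R.image f).filter fun m ↦ quadraticChar F m = 1)
      ((R.image f).filter fun m ↦ quadraticChar F m = -1)
    have := hin 1
    have := hin (-1)
    omega
  have hk7 : Nat.card k ≤ 7 := by nlinarith
  have : Fact (Nat.Prime 3) := ⟨Nat.prime_three⟩
  have : CharP F 3 := ringChar.of_eq
    (CharP.ringChar_of_prime_eq_zero Nat.prime_three (by exact_mod_cast h3))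
  obtain ⟨e, -, he⟩ := FiniteField.card F 3
  have hdvd : Nat.card k ∣ 3 ^ (e : ℕ) := by
    rw [← he, ← Nat.card_eq_fintype_card]
    exact k.toAddSubgroup.card_addSubgroup_dvd_card
  obtain ⟨i, -, hi⟩ := (Nat.dvd_prime_pow Nat.prime_three).1 hdvd
  have hi1 : i ≤ 1 := by
    by_contra! h
    have := Nat.pow_le_pow_right (show 0 < 3 by norm_num) h
    omega
  have hk3 : Nat.card k ≤ 3 := by
    rw [hi]
    calc 3 ^ i ≤ 3 ^ 1 := Nat.pow_le_pow_right (by norm_num) hi1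
      _ = 3 := by norm_num
  have hF : Fintype.card F ≤ 19 := by omega
  have he3 : (e : ℕ) < 3 := by
    by_contra! h
    have := Nat.pow_le_pow_right (show 0 < 3 by norm_num) h
    omega
  interval_cases h : (e : ℕ) <;> omega

/-- The multiplier ring of a group of translations is everything, as soon as it contains the
square ratios of the values taken by a separable quadratic. -/
lemma multiplier_eq_top (hd : β ^ 2 - 4 * γ ≠ 0) (hs : s ≠ 0) (hsβ : (2 : F) = 0 → s ≠ β)
    (hM0 : ∀ m ∈ M, m ≠ 0)
    (hMk : ∀ m ∈ M, ∀ m' ∈ M, ∀ a, m = a ^ 2 * m' → a ^ 2 ∈ k)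
    (hM : ∀ ρ y, (ρ ^ 2 + β * ρ + γ) * y ^ 2 = 1 →
      ∀ n : ℤ, ((ρ + n * s) ^ 2 + β * (ρ + n * s) + γ) * y ^ 2 ∈ M)
    (hq : 7 ≤ Fintype.card F) (hq9 : Fintype.card F ≠ 9) : k = ⊤ := by
  by_cases h2 : (2 : F) = 0
  · exact multiplier_eq_top_of_char_two hs h2 (hsβ h2) hMk hM hq
  by_cases h3 : (3 : F) = 0
  · exact multiplier_eq_top_of_char_three hd hs h2 h3 hM0 hMk hM hq hq9
  · exact multiplier_eq_top_of_five_le hd hs h2 h3 hM0 hMk hM hq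

end FieldLemmas

section Unipotent

variable {F : Type*} [Field F]

lemma SL2_det (g : SL(2, F)) : g 0 0 * g 1 1 - g 0 1 * g 1 0 = 1 := by
  have := g.det_coe
  rwa [det_fin_two] at this

lemma SL2_ext {g h : SL(2, F)} (h00 : g 0 0 = h 0 0) (h01 : g 0 1 = h 0 1)
    (h10 : g 1 0 = h 1 0) (h11 : g 1 1 = h 1 1) : g = h := by
  ext i j
  fin_cases i <;> fin_cases j <;> assumption

lemma SL2_mul_apply (g h : SL(2, F)) (i j : Fin 2) :
    (g * h) i j = g i 0 * h 0 j + g i 1 * h 1 j := by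
  change (g.1 * h.1) i j = _
  rw [mul_apply, Fin.sum_univ_two]

lemma SL2_inv_apply (g : SL(2, F)) : g⁻¹ 0 0 = g 1 1 ∧ g⁻¹ 0 1 = - g 0 1 ∧
    g⁻¹ 1 0 = - g 1 0 ∧ g⁻¹ 1 1 = g 0 0 := by
  rw [SpecialLinearGroup.SL2_inv_expl]
  simp

/-- The element of `SL(2, F)` with the given entries. -/
def mkSL2 (a b c d : F) (h : a * d - b * c = 1) : SL(2, F) :=
  ⟨!![a, b; c, d], by rwa [det_fin_two_of]⟩

section

variable (a b c d : F) (h : a * d - b * c = 1)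

@[simp] lemma mkSL2_00 : mkSL2 a b c d h 0 0 = a := rfl
@[simp] lemma mkSL2_01 : mkSL2 a b c d h 0 1 = b := rfl
@[simp] lemma mkSL2_10 : mkSL2 a b c d h 1 0 = c := rfl
@[simp] lemma mkSL2_11 : mkSL2 a b c d h 1 1 = d := rfl

end

/-- Two elements of `SL(2, F)` with the same lower left entry `c ≠ 0` agree as soon as their
diagonals do. -/
lemma SL2_ext_of_lower {g h : SL(2, F)} (h00 : g 0 0 = h 0 0)
    (h10 : g 1 0 = h 1 0) (h11 : g 1 1 = h 1 1) (hc : h 1 0 ≠ 0) : g = h := by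
  refine SL2_ext h00 ?_ h10 h11
  have e1 := SL2_det g
  have e2 := SL2_det h
  rw [h00, h10, h11] at e1
  exact mul_right_cancel₀ hc (by linear_combination e2 - e1)

/-- The upper unitriangular matrix with upper right entry `v`. -/
def upperUnip (v : F) : SL(2, F) := ⟨!![1, v; 0, 1], by simp⟩

@[simp] lemma upperUnip_00 (v : F) : upperUnip v 0 0 = 1 := rfl
@[simp] lemma upperUnip_01 (v : F) : upperUnip v 0 1 = v := rfl
@[simp] lemma upperUnip_10 (v : F) : upperUnip v 1 0 = 0 := rfl
@[simp] lemma upperUnip_11 (v : F) : upperUnip v 1 1 = 1 := rfl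

lemma upperUnip_add (v w : F) : upperUnip (v + w) = upperUnip v * upperUnip w := by
  refine SL2_ext ?_ ?_ ?_ ?_ <;> simp [SL2_mul_apply, add_comm]

lemma upperUnip_zero : upperUnip (0 : F) = 1 := by
  refine SL2_ext ?_ ?_ ?_ ?_ <;> simp

lemma upperUnip_neg (v : F) : upperUnip (-v) = (upperUnip v)⁻¹ := by
  rw [eq_inv_iff_mul_eq_one, ← upperUnip_add, neg_add_cancel, upperUnip_zero]

/-- The parameters `v` for which `upperUnip v` lies in `H`. -/
def upperUnipParams (H : Subgroup SL(2, F)) : AddSubgroup F where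
  carrier := {v | upperUnip v ∈ H}
  add_mem' {v w} hv hw := by
    rw [Set.mem_ofPred_eq, upperUnip_add]
    exact H.mul_mem hv hw
  zero_mem' := by
    rw [Set.mem_ofPred_eq, upperUnip_zero]
    exact H.one_mem
  neg_mem' {v} hv := by
    rw [Set.mem_ofPred_eq, upperUnip_neg]
    exact H.inv_mem hv

/-- The ring of scalars preserving an additive subgroup of a field. -/
def multiplierRing (V : AddSubgroup F) : Subring F where
  carrier := {r | ∀ v ∈ V, r * v ∈ V}
  mul_mem' {a b} ha hb v hv := by
    rw [mul_assoc]
    exact ha _ (hb _ hv)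
  one_mem' v hv := by rwa [one_mul]
  add_mem' {a b} ha hb v hv := by
    rw [add_mul]
    exact V.add_mem (ha _ hv) (hb _ hv)
  zero_mem' v _ := by
    rw [zero_mul]
    exact V.zero_mem
  neg_mem' {a} ha v hv := by
    rw [neg_mul]
    exact V.neg_mem (ha _ hv)

lemma mem_of_multiplierRing_eq_top {V : AddSubgroup F} (h : multiplierRing V = ⊤) {s : F}
    (hs : s ≠ 0) (hsV : s ∈ V) (v : F) : v ∈ V := by
  have h1 : v / s ∈ multiplierRing V := h ▸ Subring.mem_top _
  simpa [hs] using h1 s hsV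

lemma sq_mem_multiplierRing {H : Subgroup SL(2, F)} {g : SL(2, F)} (hg : g ∈ H)
    (h10 : g 1 0 = 0) : g 0 0 ^ 2 ∈ multiplierRing (upperUnipParams H) := by
  intro v hv
  have hd := SL2_det g
  rw [h10, mul_zero, sub_zero] at hd
  have h : upperUnip (g 0 0 ^ 2 * v) = g * upperUnip v * g⁻¹ := by
    obtain ⟨i1, i2, i3, i4⟩ := SL2_inv_apply g
    refine SL2_ext ?_ ?_ ?_ ?_ <;>
      simp only [SL2_mul_apply, i1, i2, i3, i4, h10, upperUnip_00, upperUnip_01, upperUnip_10,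
        upperUnip_11]
    · linear_combination -hd
    · ring
    · ring
    · linear_combination -hd
  change upperUnip _ ∈ H
  rw [h]
  exact H.mul_mem (H.mul_mem hg hv) (H.inv_mem hg)

lemma mem_of_lower_entry_eq {H : Subgroup SL(2, F)} (hU : ∀ v, upperUnip v ∈ H)
    {g x : SL(2, F)} (hg : g ∈ H) (hx : x 1 0 ≠ 0) (hgx : g 1 0 = x 1 0) : x ∈ H := by
  have h : x = upperUnip ((x 0 0 - g 0 0) / x 1 0) * g *
      upperUnip ((x 1 1 - g 1 1) / x 1 0) := by
    symm
    refine SL2_ext_of_lower ?_ ?_ ?_ hx <;> simp [SL2_mul_apply, hgx] <;> field_simp <;> ring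
  rw [h]
  exact H.mul_mem (H.mul_mem (hU _) hg) (hU _)

/-- A subgroup of `SL(2, F)` containing all upper unitriangular matrices and an element which is
not upper triangular is everything. -/
lemma eq_top_of_upperUnip_mem {H : Subgroup SL(2, F)} (hU : ∀ v, upperUnip v ∈ H)
    {g : SL(2, F)} (hg : g ∈ H) (hg0 : g 1 0 ≠ 0) : H = ⊤ := by
  have hne : ∀ x : SL(2, F), x 1 0 ≠ 0 → x ∈ H := by
    intro x hx
    set c := g 1 0 with hc
    have h1 : mkSL2 1 0 c 1 (by ring) ∈ H :=
      mem_of_lower_entry_eq hU hg (by simpa using hg0) (by simp [hc])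
    have h2 : mkSL2 0 (-c⁻¹) c ((x 1 0 - c) / c) (by field_simp; ring) ∈ H :=
      mem_of_lower_entry_eq hU hg (by simpa using hg0) (by simp [hc])
    refine mem_of_lower_entry_eq hU (H.mul_mem h2 h1) hx ?_
    rw [SL2_mul_apply]
    simp
    field_simp
    ring
  refine eq_top_iff.2 fun x _ ↦ ?_
  by_cases hx : x 1 0 = 0
  · have hd := SL2_det x
    rw [hx, mul_zero, sub_zero] at hd
    have h1 := hne (mkSL2 1 0 1 1 (by ring)) (by simp)
    rw [← mul_mem_cancel_right h1]
    refine hne _ ?_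
    rw [SL2_mul_apply]
    simp [hx]
    exact right_ne_zero_of_mul_eq_one hd
  · exact hne x hx

/-- Let `Q(x, y) = x² + βxy + γy²` be nondegenerate and let `H` be transitive on the level sets of
`Q`. If `H` contains a nontrivial upper unitriangular matrix, does not preserve `Q` for that
reason, and moves the first basis vector only to anisotropic vectors, then `H` contains all upper
unitriangular matrices. -/
lemma upperUnip_mem_of_transitive [Fintype F] {H : Subgroup SL(2, F)} {β γ s : F}
    (hd : β ^ 2 - 4 * γ ≠ 0)
    (htr : ∀ x y x' y', x ^ 2 + β * x * y + γ * y ^ 2 = x' ^ 2 + β * x' * y' + γ * y' ^ 2 →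
      x ^ 2 + β * x * y + γ * y ^ 2 ≠ 0 →
      ∃ h ∈ H, h 0 0 * x + h 0 1 * y = x' ∧ h 1 0 * x + h 1 1 * y = y')
    (hs : s ≠ 0) (hsH : upperUnip s ∈ H) (hsβ : (2 : F) = 0 → s ≠ β)
    (haniso : ∀ h ∈ H, h 0 0 ^ 2 + β * h 0 0 * h 1 0 + γ * h 1 0 ^ 2 ≠ 0)
    (hq : 7 ≤ Fintype.card F) (hq9 : Fintype.card F ≠ 9) (v : F) : upperUnip v ∈ H := by
  have htop : multiplierRing (upperUnipParams H) = ⊤ := by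
    refine multiplier_eq_top (β := β) (γ := γ) (s := s)
      (M := {m | ∃ h ∈ H, h 0 0 ^ 2 + β * h 0 0 * h 1 0 + γ * h 1 0 ^ 2 = m})
      hd hs hsβ ?_ ?_ ?_ hq hq9
    · rintro _ ⟨h, hh, rfl⟩
      exact haniso h hh
    · rintro _ ⟨h, hh, rfl⟩ _ ⟨g, hg, rfl⟩ a ha
      obtain ⟨t, ht, h0, h1⟩ := htr (h 0 0) (h 1 0) (a * g 0 0) (a * g 1 0)
        (by linear_combination ha) (haniso h hh)
      obtain ⟨i1, i2, i3, i4⟩ := SL2_inv_apply g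
      have hdet := SL2_det g
      have hmem : g⁻¹ * (t * h) ∈ H := H.mul_mem (H.inv_mem hg) (H.mul_mem ht hh)
      have e0 : (g⁻¹ * (t * h)) 0 0 = a := by
        rw [SL2_mul_apply, SL2_mul_apply, SL2_mul_apply, i1, i2, h0, h1]
        linear_combination a * hdet
      have e1 : (g⁻¹ * (t * h)) 1 0 = 0 := by
        rw [SL2_mul_apply, SL2_mul_apply, SL2_mul_apply, i3, i4, h0, h1]
        ring
      rw [← e0]
      exact sq_mem_multiplierRing hmem e1
    · intro ρ y hρ n
      obtain ⟨t, ht, h0, h1⟩ := htr 1 0 (ρ * y) y (by linear_combination -hρ) (by simp)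
      have hns : upperUnip ((n : F) * s) ∈ H := by
        have : n • s ∈ upperUnipParams H := (upperUnipParams H).zsmul_mem hsH n
        rwa [zsmul_eq_mul] at this
      refine ⟨_, H.mul_mem hns ht, ?_⟩
      simp only [SL2_mul_apply, upperUnip_00, upperUnip_01, upperUnip_10, upperUnip_11]
      have e0 : t 0 0 = ρ * y := by linear_combination h0
      have e1 : t 1 0 = y := by linear_combination h1
      rw [e0, e1]
      ring
  exact mem_of_multiplierRing_eq_top htop hs hsH v

end Unipotent

section Powers

variable {F : Type*} [Field F]

lemma SL2_mem_center_iff (g : SL(2, F)) :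
    g ∈ Subgroup.center SL(2, F) ↔ g 0 1 = 0 ∧ g 1 0 = 0 ∧ g 0 0 = g 1 1 := by
  constructor
  · intro h
    have h1 := (Subgroup.mem_center_iff.1 h) (upperUnip 1)
    have h2 := (Subgroup.mem_center_iff.1 h) (mkSL2 1 0 1 1 (by ring))
    have e1 := congrArg (fun x : SL(2, F) ↦ x 0 0) h1
    have e2 := congrArg (fun x : SL(2, F) ↦ x 0 0) h2
    have e3 := congrArg (fun x : SL(2, F) ↦ x 0 1) h1
    simp [SL2_mul_apply] at e1 e2 e3
    exact ⟨e2, e1, by linear_combination -e3⟩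
  · rintro ⟨h1, h2, h3⟩
    refine Subgroup.mem_center_iff.2 fun x ↦ ?_
    refine SL2_ext ?_ ?_ ?_ ?_ <;> simp only [SL2_mul_apply, h1, h2, h3] <;> ring

/-- Powers of a matrix with trace `α` and of roots of `w² = αw - 1` are given by the same linear
polynomials. -/
lemma exists_pow_coeff {L : Type*} [Field L] [Algebra F L] {B : SL(2, F)} {α : F}
    (hB : B 0 0 + B 1 1 = α) (i : ℕ) :
    ∃ x y : F, (B ^ i) 0 0 = x + y * B 0 0 ∧ (B ^ i) 0 1 = y * B 0 1 ∧
      (B ^ i) 1 0 = y * B 1 0 ∧ (B ^ i) 1 1 = x + y * B 1 1 ∧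
      ∀ w : L, w ^ 2 = algebraMap F L α * w - 1 →
        w ^ i = algebraMap F L x + algebraMap F L y * w := by
  have hd := SL2_det B
  induction i with
  | zero => exact ⟨1, 0, by simp⟩
  | succ i ih =>
    obtain ⟨x, y, h1, h2, h3, h4, h5⟩ := ih
    refine ⟨-y, x + α * y, ?_, ?_, ?_, ?_, ?_⟩
    · rw [pow_succ, SL2_mul_apply, h1, h2, ← hB]
      linear_combination -y * hd
    · rw [pow_succ, SL2_mul_apply, h1, h2, ← hB]
      ring
    · rw [pow_succ, SL2_mul_apply, h3, h4, ← hB]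
      ring
    · rw [pow_succ, SL2_mul_apply, h3, h4, ← hB]
      linear_combination -y * hd
    · intro w hw
      rw [pow_succ, h5 w hw]
      simp only [map_add, map_mul, map_neg]
      linear_combination algebraMap F L y * hw

variable {L : Type*} [Field L] [Algebra F L] {ω : L} {α : F}

lemma sq_eq_of_add_inv (h0 : ω ≠ 0) (hα : ω + ω⁻¹ = algebraMap F L α) :
    ω ^ 2 = algebraMap F L α * ω - 1 ∧ ω⁻¹ ^ 2 = algebraMap F L α * ω⁻¹ - 1 := by
  rw [← hα]
  constructor <;> field_simp <;> ring

lemma sub_inv_ne_zero (h0 : ω ≠ 0) (h1 : ω ^ 2 ≠ 1) : ω - ω⁻¹ ≠ 0 := by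
  intro h
  apply h1
  field_simp at h
  linear_combination h

lemma disc_ne_zero (h0 : ω ≠ 0) (hα : ω + ω⁻¹ = algebraMap F L α) (h1 : ω ^ 2 ≠ 1) :
    α ^ 2 - 4 * 1 ≠ 0 := by
  intro h
  have h2 := congrArg (algebraMap F L) h
  simp only [map_sub, map_mul, map_pow, map_one, map_zero, ← hα, map_ofNat] at h2
  refine sub_inv_ne_zero h0 h1 (pow_eq_zero_iff two_ne_zero |>.1 ?_)
  rw [← h2]
  field_simp
  ring

lemma pow_mem_center_iff (h0 : ω ≠ 0) (hα : ω + ω⁻¹ = algebraMap F L α) (h1 : ω ^ 2 ≠ 1)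
    {B : SL(2, F)} (hB : B 0 0 + B 1 1 = α) (i : ℕ) :
    B ^ i ∈ Subgroup.center SL(2, F) ↔ ω ^ (2 * i) = 1 := by
  obtain ⟨x, y, e1, e2, e3, e4, e5⟩ := exists_pow_coeff (L := L) hB i
  obtain ⟨s1, s2⟩ := sq_eq_of_add_inv h0 hα
  have f1 := e5 _ s1
  have f2 := e5 _ s2
  have hω : ω ^ (2 * i) * (ω⁻¹) ^ i = ω ^ i := by
    rw [inv_pow]
    field_simp
    ring
  have hne := sub_inv_ne_zero h0 h1
  rw [SL2_mem_center_iff, e1, e2, e3, e4]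
  constructor
  · rintro ⟨g1, g2, g3⟩
    have hy : y = 0 := by
      by_contra hy
      have k1 := (mul_eq_zero.1 g1).resolve_left hy
      have k3 : B 0 0 = B 1 1 := mul_left_cancel₀ hy (by linear_combination g3)
      have hd := SL2_det B
      refine disc_ne_zero h0 hα h1 ?_
      rw [← hB, k3]
      rw [k1, k3] at hd
      linear_combination 4 * hd
    have h3 : ω ^ i = ω⁻¹ ^ i := by
      rw [f1, f2, hy]
      simp
    rw [h3] at hω
    exact mul_right_cancel₀ (pow_ne_zero i (inv_ne_zero h0)) (by rw [hω, one_mul])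
  · intro h
    rw [h, one_mul, f1, f2] at hω
    have : algebraMap F L y * (ω - ω⁻¹) = 0 := by linear_combination -hω
    have hy : y = 0 := by
      simpa using (mul_eq_zero.1 this).resolve_right hne
    simp [hy]

lemma orderOf_mk_eq (h0 : ω ≠ 0) (hα : ω + ω⁻¹ = algebraMap F L α) {n : ℕ} (hn : 2 < n)
    (ho : ∀ i, ω ^ (2 * i) = 1 ↔ n ∣ 2 * i) {B : SL(2, F)} (hB : B 0 0 + B 1 1 = α) :
    orderOf (QuotientGroup.mk B : PSL2 F) = n / Nat.gcd 2 n := by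
  have h1 : ω ^ 2 ≠ 1 := by
    intro h
    have := Nat.le_of_dvd (by norm_num) ((ho 1).1 (by simpa using h))
    omega
  refine (Nat.dvd_right_iff_eq).1 fun i ↦ ?_
  rw [orderOf_dvd_iff_pow_eq_one, ← QuotientGroup.mk_pow, QuotientGroup.eq_one_iff,
    pow_mem_center_iff h0 hα h1 hB, ho]
  have hg : 0 < Nat.gcd 2 n := Nat.gcd_pos_of_pos_left _ (by norm_num)
  obtain ⟨m, hm⟩ := Nat.gcd_dvd_right 2 n
  constructor
  · intro h
    refine (Nat.Coprime.dvd_of_dvd_mul_left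
      (Nat.coprime_div_gcd_div_gcd (m := 2) (n := n) hg).symm) ?_
    rw [← Nat.mul_dvd_mul_iff_left hg, ← mul_assoc, Nat.mul_div_cancel' (Nat.gcd_dvd_left 2 n),
      Nat.mul_div_cancel' (Nat.gcd_dvd_right 2 n)]
    exact h
  · intro h
    have h2 := Nat.mul_dvd_mul (Nat.gcd_dvd_left 2 n) h
    rwa [Nat.mul_div_cancel' (Nat.gcd_dvd_right 2 n)] at h2

lemma closure_mk_eq_top {a b : SL(2, F)}
    (h : ∀ H : Subgroup SL(2, F), a ∈ H → b ∈ H → H = ⊤) :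
    Subgroup.closure {(QuotientGroup.mk a : PSL2 F), QuotientGroup.mk b} = ⊤ := by
  set K := Subgroup.closure {(QuotientGroup.mk a : PSL2 F), QuotientGroup.mk b} with hK
  have h1 := h (K.comap (QuotientGroup.mk' _)) (Subgroup.subset_closure (by simp))
    (Subgroup.subset_closure (by simp))
  refine eq_top_iff.2 fun x _ ↦ ?_
  obtain ⟨y, rfl⟩ := QuotientGroup.mk_surjective x
  have : y ∈ K.comap (QuotientGroup.mk' _) := h1 ▸ Subgroup.mem_top y
  exact this

/-- The companion matrix of `X² - αX + 1`. -/
def companionSL2 (α : F) : SL(2, F) := mkSL2 0 (-1) 1 α (by ring)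

@[simp] lemma companionSL2_00 (α : F) : companionSL2 α 0 0 = 0 := rfl
@[simp] lemma companionSL2_01 (α : F) : companionSL2 α 0 1 = -1 := rfl
@[simp] lemma companionSL2_10 (α : F) : companionSL2 α 1 0 = 1 := rfl
@[simp] lemma companionSL2_11 (α : F) : companionSL2 α 1 1 = α := rfl

/-- If the norm one elements `x + yω` are powers of `ω`, then the corresponding matrices are
powers of the companion matrix. -/
lemma exists_companionSL2_pow (h0 : ω ≠ 0) (hα : ω + ω⁻¹ = algebraMap F L α) (h1 : ω ^ 2 ≠ 1)
    (hpow : ∀ x y : F, x ^ 2 + α * x * y + 1 * y ^ 2 = 1 →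
      ∃ i : ℕ, ω ^ i = algebraMap F L x + algebraMap F L y * ω)
    {u v : F} (huv : u ^ 2 + α * u * v + 1 * v ^ 2 = 1) :
    ∃ i : ℕ, (companionSL2 α ^ i) 0 0 = u ∧ (companionSL2 α ^ i) 0 1 = -v ∧
      (companionSL2 α ^ i) 1 0 = v ∧ (companionSL2 α ^ i) 1 1 = u + v * α := by
  obtain ⟨i, hi⟩ := hpow u v huv
  obtain ⟨x, y, e1, e2, e3, e4, e5⟩ := exists_pow_coeff (L := L)
    (B := companionSL2 α) (α := α) (by simp) i
  obtain ⟨s1, s2⟩ := sq_eq_of_add_inv h0 hα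
  have f1 := e5 _ s1
  have f2 := e5 _ s2
  have hi2 : ω⁻¹ ^ i = algebraMap F L u + algebraMap F L v * ω⁻¹ := by
    rw [inv_pow]
    refine inv_eq_of_mul_eq_one_right ?_
    rw [hi]
    have := congrArg (algebraMap F L) huv
    simp only [map_add, map_mul, map_pow, map_one, ← hα] at this
    linear_combination this + (algebraMap F L v) ^ 2 * mul_inv_cancel₀ h0
  have hne := sub_inv_ne_zero h0 h1
  have hv : algebraMap F L v = algebraMap F L y := by
    refine mul_right_cancel₀ hne ?_
    linear_combination f1 - f2 - hi + hi2
  have hu : algebraMap F L u = algebraMap F L x := by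
    rw [hv] at hi
    linear_combination f1 - hi
  have hv' := (algebraMap F L).injective hv
  have hu' := (algebraMap F L).injective hu
  subst hv' hu'
  exact ⟨i, by simp [e1], by simp [e2], by simp [e3], by simp [e4]⟩

lemma exists_mem_of_level_set_eq (h0 : ω ≠ 0) (hα : ω + ω⁻¹ = algebraMap F L α) (h1 : ω ^ 2 ≠ 1)
    (hpow : ∀ x y : F, x ^ 2 + α * x * y + 1 * y ^ 2 = 1 →
      ∃ i : ℕ, ω ^ i = algebraMap F L x + algebraMap F L y * ω)
    {H : Subgroup SL(2, F)} (hA : companionSL2 α ∈ H) (x y x' y' : F)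
    (hQ : x ^ 2 + α * x * y + 1 * y ^ 2 = x' ^ 2 + α * x' * y' + 1 * y' ^ 2)
    (hQ0 : x ^ 2 + α * x * y + 1 * y ^ 2 ≠ 0) :
    ∃ h ∈ H, h 0 0 * x + h 0 1 * y = x' ∧ h 1 0 * x + h 1 1 * y = y' := by
  set N := x ^ 2 + α * x * y + 1 * y ^ 2 with hN
  have huv : ((x' * (x + α * y) + y' * y) / N) ^ 2 +
      α * ((x' * (x + α * y) + y' * y) / N) * ((y' * x - x' * y) / N) +
      1 * ((y' * x - x' * y) / N) ^ 2 = 1 := by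
    have : (x' * (x + α * y) + y' * y) ^ 2 +
        α * (x' * (x + α * y) + y' * y) * (y' * x - x' * y) + (y' * x - x' * y) ^ 2 =
        N * N := by
      nth_rewrite 1 [hN]
      rw [hQ]
      ring
    field_simp
    linear_combination this
  obtain ⟨i, e1, e2, e3, e4⟩ := exists_companionSL2_pow h0 hα h1 hpow huv
  refine ⟨_, H.pow_mem hA i, ?_, ?_⟩
  · rw [e1, e2]
    field_simp
    rw [hN]
    ring
  · rw [e3, e4]
    field_simp
    rw [hN]
    ring

end Powers

section Split

variable {F : Type*} [Field F]

/-- The matrix `g` stabilises a line of `F²`. -/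
def StabilizesLine (g : SL(2, F)) : Prop :=
  ∃ x y : F, (x ≠ 0 ∨ y ≠ 0) ∧ g 1 0 * x ^ 2 + (g 1 1 - g 0 0) * x * y - g 0 1 * y ^ 2 = 0

lemma StabilizesLine.pow {g : SL(2, F)} (hg : StabilizesLine g) (i : ℕ) :
    StabilizesLine (g ^ i) := by
  obtain ⟨x, y, hxy, h⟩ := hg
  obtain ⟨u, v, e1, e2, e3, e4, -⟩ := exists_pow_coeff (L := F) (B := g) rfl i
  refine ⟨x, y, hxy, ?_⟩
  rw [e1, e2, e3, e4]
  linear_combination v * h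

lemma StabilizesLine.conj {k : SL(2, F)} (hk : StabilizesLine k) (g : SL(2, F)) :
    StabilizesLine (g * k * g⁻¹) := by
  obtain ⟨x, y, hxy, h⟩ := hk
  have hd := SL2_det g
  refine ⟨g 0 0 * x + g 0 1 * y, g 1 0 * x + g 1 1 * y, ?_, ?_⟩
  · by_contra! h0
    have hx : x = 0 := by linear_combination g 1 1 * h0.1 - g 0 1 * h0.2 - x * hd
    have hy : y = 0 := by linear_combination g 0 0 * h0.2 - g 1 0 * h0.1 - y * hd
    simp [hx, hy] at hxy
  · obtain ⟨i1, i2, i3, i4⟩ := SL2_inv_apply g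
    simp only [SL2_mul_apply, i1, i2, i3, i4]
    linear_combination (g 0 0 * g 1 1 - g 0 1 * g 1 0) ^ 2 * h

lemma StabilizesLine.mul_center {k c : SL(2, F)} (hk : StabilizesLine k)
    (hc : c ∈ Subgroup.center SL(2, F)) : StabilizesLine (k * c) := by
  obtain ⟨x, y, hxy, h⟩ := hk
  obtain ⟨c1, c2, c3⟩ := (SL2_mem_center_iff c).1 hc
  refine ⟨x, y, hxy, ?_⟩
  simp only [SL2_mul_apply, c1, c2, c3]
  linear_combination c 1 1 * h

lemma stabilizesLine_upperUnip (s : F) : StabilizesLine (upperUnip s) :=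
  ⟨1, 0, by simp, by simp⟩

lemma stabilizesLine_of_root {B : SL(2, F)} {α r : F} (hB : B 0 0 + B 1 1 = α)
    (hr : r ^ 2 - α * r + 1 = 0) : StabilizesLine B := by
  have hd := SL2_det B
  by_cases h : B 0 1 = 0
  · exact ⟨0, 1, by simp, by simp [h]⟩
  · refine ⟨B 0 1, r - B 0 0, Or.inl h, ?_⟩
    rw [← hB] at hr
    linear_combination -B 0 1 * hr - B 0 1 * hd

lemma exists_root_of_stabilizesLine {B : SL(2, F)} {α : F} (hB : B 0 0 + B 1 1 = α)
    (h : StabilizesLine B) : ∃ r, r ^ 2 - α * r + 1 = 0 := by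
  obtain ⟨x, y, hxy, h⟩ := h
  have hd := SL2_det B
  subst hB
  by_cases hx : x = 0
  · subst hx
    simp only [ne_eq, not_true_eq_false, false_or] at hxy
    have h01 : B 0 1 = 0 := by
      refine (mul_eq_zero.1 (?_ : B 0 1 * y ^ 2 = 0)).resolve_right (pow_ne_zero 2 hxy)
      linear_combination -h
    refine ⟨B 1 1, ?_⟩
    rw [h01] at hd
    linear_combination -hd
  · refine ⟨B 0 0 + B 0 1 * y / x, ?_⟩
    field_simp
    linear_combination -B 0 1 * h - x ^ 2 * hd

lemma pow_mem_center_of_stabilizesLine {B : SL(2, F)} {α : F} (hB : B 0 0 + B 1 1 = α)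
    (hα : ∀ r, r ^ 2 - α * r + 1 ≠ 0) {i : ℕ} (h : StabilizesLine (B ^ i)) :
    B ^ i ∈ Subgroup.center SL(2, F) := by
  obtain ⟨u, v, e1, e2, e3, e4, -⟩ := exists_pow_coeff (L := F) hB i
  obtain ⟨x, y, hxy, h⟩ := h
  by_cases hv : v = 0
  · rw [SL2_mem_center_iff, e1, e2, e3, e4, hv]
    simp
  · obtain ⟨r, hr⟩ := exists_root_of_stabilizesLine hB ⟨x, y, hxy, by
      rw [e1, e2, e3, e4] at h
      exact (mul_eq_zero.1 (by linear_combination h)).resolve_left hv⟩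
    exact absurd hr (hα r)

lemma exists_stabilizesLine_of_mem_conjPowers {a : SL(2, F)} (ha : StabilizesLine a)
    {x : PSL2 F} (hx : x ∈ conjPowers (QuotientGroup.mk a : PSL2 F)) :
    ∃ g : SL(2, F), QuotientGroup.mk g = x ∧ StabilizesLine g := by
  obtain ⟨g, j, rfl⟩ := hx
  obtain ⟨g, rfl⟩ := QuotientGroup.mk_surjective g
  exact ⟨g * a ^ j * g⁻¹, rfl, (ha.pow j).conj g⟩

lemma eq_one_of_mem_conjPowers {B : SL(2, F)} {α : F} (hB : B 0 0 + B 1 1 = α)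
    (hα : ∀ r, r ^ 2 - α * r + 1 ≠ 0) {h : SL(2, F)} (hh : StabilizesLine h)
    (hx : (QuotientGroup.mk h : PSL2 F) ∈ conjPowers (QuotientGroup.mk B : PSL2 F)) :
    (QuotientGroup.mk h : PSL2 F) = 1 := by
  obtain ⟨g, j, hg⟩ := hx
  obtain ⟨g, rfl⟩ := QuotientGroup.mk_surjective g
  have h1 : (QuotientGroup.mk (g⁻¹ * h * g⁻¹⁻¹) : PSL2 F) = QuotientGroup.mk (B ^ j) := by
    rw [inv_inv, QuotientGroup.mk_mul, QuotientGroup.mk_mul, hg, QuotientGroup.mk_pow,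
      QuotientGroup.mk_inv]
    group
  have h2 := (hh.conj g⁻¹).mul_center (QuotientGroup.eq.1 h1)
  rw [mul_inv_cancel_left] at h2
  have h3 := (QuotientGroup.eq_one_iff _).2 (pow_mem_center_of_stabilizesLine hB hα h2)
  rw [hg, ← QuotientGroup.mk_pow, h3]
  group

lemma sigma3_inter_eq_one {a b c A B C : SL(2, F)} {α : F} (ha : StabilizesLine a)
    (hb : StabilizesLine b) (hc : StabilizesLine c) (hA : A 0 0 + A 1 1 = α)
    (hB : B 0 0 + B 1 1 = α) (hC : C 0 0 + C 1 1 = α) (hα : ∀ r, r ^ 2 - α * r + 1 ≠ 0) :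
    sigma3 (QuotientGroup.mk a : PSL2 F) (QuotientGroup.mk b) (QuotientGroup.mk c) ∩
      sigma3 (QuotientGroup.mk A : PSL2 F) (QuotientGroup.mk B) (QuotientGroup.mk C) = {1} := by
  have hone : ∀ x : PSL2 F, (1 : PSL2 F) ∈ conjPowers x := fun x ↦ ⟨1, 0, by simp⟩
  refine Set.Subset.antisymm ?_ ?_
  · rintro x ⟨h1, h2⟩
    obtain ⟨g, rfl, hg⟩ : ∃ g : SL(2, F), QuotientGroup.mk g = x ∧ StabilizesLine g := by
      rcases h1 with (h1 | h1) | h1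
      · exact exists_stabilizesLine_of_mem_conjPowers ha h1
      · exact exists_stabilizesLine_of_mem_conjPowers hb h1
      · exact exists_stabilizesLine_of_mem_conjPowers hc h1
    rcases h2 with (h2 | h2) | h2
    · exact eq_one_of_mem_conjPowers hA hα hg h2
    · exact eq_one_of_mem_conjPowers hB hα hg h2
    · exact eq_one_of_mem_conjPowers hC hα hg h2
  · rintro x rfl
    exact ⟨Or.inr (hone _), Or.inr (hone _)⟩

lemma upperUnip_pow (s : F) (n : ℕ) : upperUnip s ^ n = upperUnip (n * s) := by
  induction n with
  | zero => simp [upperUnip_zero]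
  | succ n ih =>
    rw [pow_succ, ih, ← upperUnip_add]
    congr 1
    push_cast
    ring

lemma orderOf_mk_upperUnip (p : ℕ) [CharP F p] {s : F} (hs : s ≠ 0) :
    orderOf (QuotientGroup.mk (upperUnip s) : PSL2 F) = p := by
  refine (Nat.dvd_right_iff_eq).1 fun i ↦ ?_
  rw [orderOf_dvd_iff_pow_eq_one, ← QuotientGroup.mk_pow, QuotientGroup.eq_one_iff,
    upperUnip_pow, SL2_mem_center_iff, ← CharP.cast_eq_zero_iff F p i]
  simp [hs]

variable [Fintype F]

lemma multiplierRing_eq_top_of_generator {k : Subring F} {ζ : Fˣ}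
    (hζ : ∀ x : Fˣ, ∃ i : ℕ, ζ ^ i = x) (h : (ζ : F) ^ 2 ∈ k) : k = ⊤ := by
  have hsq : ∀ x : F, x ^ 2 ∈ k := by
    intro x
    rcases eq_or_ne x 0 with rfl | hx
    · simp
    · obtain ⟨i, hi⟩ := hζ (Units.mk0 x hx)
      have hi' : (ζ : F) ^ i = x := by
        rw [← Units.val_pow_eq_pow_val, hi, Units.val_mk0]
      rw [← hi', ← pow_mul, mul_comm, pow_mul]
      exact k.pow_mem h i
  refine eq_top_iff.2 fun x _ ↦ ?_
  by_cases h2 : (2 : F) = 0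
  · obtain ⟨y, hy⟩ := FiniteField.isSquare_of_char_two
      (CharP.ringChar_of_prime_eq_zero Nat.prime_two (by exact_mod_cast h2)) x
    rw [hy, ← sq]
    exact hsq y
  · have h3 : x = ((x + 1) / 2) ^ 2 - ((x - 1) / 2) ^ 2 := by
      field_simp
      ring
    rw [h3]
    exact k.sub_mem (hsq _) (hsq _)

lemma eq_top_of_companionSL2_of_upperUnip {ζ : Fˣ} (hζ : ∀ x : Fˣ, ∃ i : ℕ, ζ ^ i = x)
    (hζ2 : (ζ : F) ^ 2 ≠ 1) {s t : F} (ht : t = ζ + (ζ : F)⁻¹) (hs : s ≠ 0)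
    (hst : (2 : F) = 0 → s ≠ t) (hq : 7 ≤ Fintype.card F) (hq9 : Fintype.card F ≠ 9)
    {H : Subgroup SL(2, F)} (hA : companionSL2 t ∈ H) (hC : upperUnip s ∈ H) : H = ⊤ := by
  have h0 : (ζ : F) ≠ 0 := ζ.ne_zero
  have hα : (ζ : F) + (ζ : F)⁻¹ = algebraMap F F t := ht.symm
  refine eq_top_of_upperUnip_mem (g := companionSL2 t) (fun v ↦ ?_) hA (by simp)
  by_cases haniso : ∀ h ∈ H, h 0 0 ^ 2 + t * h 0 0 * h 1 0 + 1 * h 1 0 ^ 2 ≠ 0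
  · refine upperUnip_mem_of_transitive (disc_ne_zero h0 hα hζ2)
      (fun x y x' y' ↦ exists_mem_of_level_set_eq h0 hα hζ2 ?_ hA x y x' y') hs hC hst haniso
      hq hq9 v
    intro x y hxy
    have hne : x + y * ζ ≠ 0 := by
      intro h
      have : (x + y * ζ) * (x + y * (ζ : F)⁻¹) = 1 := by
        rw [← hxy, ht]
        field_simp
        ring
      simp [h] at this
    obtain ⟨i, hi⟩ := hζ (Units.mk0 _ hne)
    refine ⟨i, ?_⟩
    rw [← Units.val_pow_eq_pow_val, hi]
    rfl
  · push Not at haniso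
    obtain ⟨h, hh, hQ⟩ := haniso
    obtain ⟨i1, i2, i3, i4⟩ := SL2_inv_apply h
    set g := h⁻¹ * (companionSL2 t * h) with hg
    have hgH : g ∈ H := H.mul_mem (H.inv_mem hh) (H.mul_mem hA hh)
    have hdh := SL2_det h
    have e00 : g 0 0 = h 1 1 * (-h 1 0) - h 0 1 * (h 0 0 + t * h 1 0) := by
      simp [hg, SL2_mul_apply, i1, i2]
      ring
    have e10 : g 1 0 = 0 := by
      rw [← hQ]
      simp [hg, SL2_mul_apply, i3, i4]
      ring
    have e11 : g 1 1 = t - g 0 0 := by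
      rw [e00]
      simp [hg, SL2_mul_apply, i3, i4]
      linear_combination t * hdh
    have hd := SL2_det g
    rw [e10, e11] at hd
    have hroot : (g 0 0 - ζ) * (g 0 0 - (ζ : F)⁻¹) = 0 := by
      rw [ht] at hd
      field_simp at hd ⊢
      linear_combination -hd
    refine mem_of_multiplierRing_eq_top
      (multiplierRing_eq_top_of_generator hζ ?_) hs (V := upperUnipParams H) hC v
    have hk := sq_mem_multiplierRing hgH e10
    rcases mul_eq_zero.1 hroot with h | h
    · rwa [sub_eq_zero.1 h] at hk
    · rw [sub_eq_zero.1 h] at hk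
      have := Subring.inv_mem_of_fintype _ hk
      rwa [inv_pow, inv_inv] at this

lemma exists_split_triple (p : ℕ) [CharP F p] (hq : 7 ≤ Fintype.card F)
    (hq9 : Fintype.card F ≠ 9) :
    ∃ a b c : SL(2, F), a * b * c = 1 ∧ StabilizesLine a ∧ StabilizesLine b ∧ StabilizesLine c ∧
      (∀ H : Subgroup SL(2, F), a ∈ H → b ∈ H → H = ⊤) ∧
      orderOf (QuotientGroup.mk a : PSL2 F) =
        (Fintype.card F - 1) / Nat.gcd 2 (Fintype.card F - 1) ∧
      orderOf (QuotientGroup.mk b : PSL2 F) =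
        (Fintype.card F - 1) / Nat.gcd 2 (Fintype.card F - 1) ∧
      orderOf (QuotientGroup.mk c : PSL2 F) = p := by
  classical
  obtain ⟨ζ, hζz⟩ := IsCyclic.exists_generator (α := Fˣ)
  have hζ : ∀ x : Fˣ, ∃ i : ℕ, ζ ^ i = x := fun x ↦ mem_powers_iff_mem_zpowers.2 (hζz x)
  have hord : orderOf (ζ : F) = Fintype.card F - 1 := by
    rw [orderOf_units, orderOf_eq_card_of_forall_mem_zpowers hζz, Nat.card_eq_fintype_card,
      Fintype.card_units]
  have h0 : (ζ : F) ≠ 0 := ζ.ne_zero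
  have ho : ∀ i, (ζ : F) ^ (2 * i) = 1 ↔ Fintype.card F - 1 ∣ 2 * i := fun i ↦ by
    rw [← hord, orderOf_dvd_iff_pow_eq_one]
  have hsmall : ∀ n, 0 < n → n < 6 → (ζ : F) ^ n ≠ 1 := by
    intro n hn hn6 h
    have := Nat.le_of_dvd hn (orderOf_dvd_iff_pow_eq_one.2 h)
    omega
  have hn : 2 < Fintype.card F - 1 := by omega
  set t := (ζ : F) + (ζ : F)⁻¹ with ht
  obtain ⟨s, μ, hs, hst, hμ0, hμ, hoμ⟩ : ∃ s μ : F, s ≠ 0 ∧ ((2 : F) = 0 → s ≠ t) ∧ μ ≠ 0 ∧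
      μ + μ⁻¹ = s + t ∧ ∀ i, μ ^ (2 * i) = 1 ↔ Fintype.card F - 1 ∣ 2 * i := by
    have ht0 : t ≠ 0 := by
      intro h
      apply hsmall 4 (by norm_num) (by norm_num)
      have : (ζ : F) ^ 2 = -1 := by
        rw [ht] at h
        field_simp at h
        linear_combination h
      rw [show 4 = 2 * 2 by norm_num, pow_mul, this]
      ring
    by_cases h2 : (2 : F) = 0
    · refine ⟨t + t ^ 2, (ζ : F) ^ 2, ?_, ?_, pow_ne_zero 2 h0, ?_, ?_⟩
      · intro h
        have h1 : t + 1 = 0 := by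
          refine (mul_eq_zero.1 (?_ : t * (t + 1) = 0)).resolve_left ht0
          linear_combination h
        apply hsmall 3 (by norm_num) (by norm_num)
        rw [ht] at h1
        field_simp at h1
        linear_combination ((ζ : F) - 1) * h1
      · intro _ h
        apply pow_ne_zero 2 ht0
        linear_combination h
      · rw [ht]
        field_simp
        linear_combination (-(ζ : F) ^ 3 - (ζ : F) ^ 2 - ζ) * h2
      · intro i
        rw [← ho, ← pow_mul, mul_comm 2 (2 * i), pow_mul]
        constructor
        · intro h
          refine sub_eq_zero.1 (pow_eq_zero_iff two_ne_zero |>.1 ?_)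
          linear_combination h + (1 - (ζ : F) ^ (2 * i)) * h2
        · intro h
          rw [h, one_pow]
    · refine ⟨-2 * t, -ζ, ?_, fun h ↦ absurd h h2, neg_ne_zero.2 h0, ?_, ?_⟩
      · exact mul_ne_zero (neg_ne_zero.2 h2) ht0
      · rw [inv_neg, ht]
        ring
      · intro i
        rw [pow_mul, neg_sq, ← pow_mul, ho]
  obtain ⟨i1, i2, i3, i4⟩ := SL2_inv_apply (upperUnip s * companionSL2 t)
  have htrb : (upperUnip s * companionSL2 t)⁻¹ 0 0 + (upperUnip s * companionSL2 t)⁻¹ 1 1 =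
      s + t := by
    rw [i1, i4]
    simp [SL2_mul_apply]
    ring
  refine ⟨companionSL2 t, (upperUnip s * companionSL2 t)⁻¹, upperUnip s, by group, ?_, ?_,
    stabilizesLine_upperUnip s, ?_, ?_, ?_, orderOf_mk_upperUnip p hs⟩
  · refine stabilizesLine_of_root (α := t) (r := ζ) (by simp) ?_
    rw [ht]
    field_simp
    ring
  · refine stabilizesLine_of_root (r := μ) htrb ?_
    rw [← hμ]
    field_simp
    ring
  · intro H hA hB
    refine eq_top_of_companionSL2_of_upperUnip hζ (hsmall 2 (by norm_num) (by norm_num)) ht hs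
      hst hq hq9 hA ?_
    have h := H.mul_mem (H.inv_mem hB) (H.inv_mem hA)
    rwa [inv_inv, mul_inv_cancel_right] at h
  · exact orderOf_mk_eq (L := F) (α := t) h0 ht.symm hn ho (by simp)
  · exact orderOf_mk_eq (L := F) hμ0 hμ hn hoμ htrb

end Split

section NonsplitTrace

variable {F : Type*} [Field F] [Fintype F]

open Polynomial in
lemma exists_algebraMap_eq_of_pow_card_eq {L : Type*} [Field L] [Algebra F L] {x : L}
    (hx : x ^ Fintype.card F = x) : ∃ a : F, algebraMap F L a = x := by
  classical
  set S : Finset L := Finset.univ.image (algebraMap F L) with hS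
  have hScard : S.card = Fintype.card F := by
    rw [hS, Finset.card_image_of_injective _ (algebraMap F L).injective, Finset.card_univ]
  have hne : (X ^ Fintype.card F - X : L[X]) ≠ 0 :=
    FiniteField.X_pow_card_sub_X_ne_zero L Fintype.one_lt_card
  have hsub : S ⊆ (X ^ Fintype.card F - X : L[X]).roots.toFinset := by
    intro y hy
    obtain ⟨a, -, rfl⟩ := Finset.mem_image.1 hy
    rw [Multiset.mem_toFinset, mem_roots hne]
    simp [← map_pow, FiniteField.pow_card]
  have hle : (X ^ Fintype.card F - X : L[X]).roots.toFinset.card ≤ S.card := by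
    rw [hScard]
    calc _ ≤ _ := Multiset.toFinset_card_le _
      _ ≤ _ := card_roots' _
      _ = _ := FiniteField.X_pow_card_sub_X_natDegree_eq L Fintype.one_lt_card
  have hmem : x ∈ S := by
    rw [Finset.eq_of_subset_of_card_le hsub hle, Multiset.mem_toFinset, mem_roots hne]
    simp [hx]
  obtain ⟨a, -, ha⟩ := Finset.mem_image.1 hmem
  exact ⟨a, ha⟩

/-- `α` is the trace `ω + ω⁻¹` of a generator `ω` of the group of norm one elements of the
quadratic extension of `F`, taken inside `L`. -/
structure IsNonsplitTrace {L : Type*} [Field L] [Algebra F L] (α : F) (ω : L) : Prop where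
  ne_zero : ω ≠ 0
  add_inv : ω + ω⁻¹ = algebraMap F L α
  pow_eq_one_iff : ∀ i : ℕ, ω ^ i = 1 ↔ Fintype.card F + 1 ∣ i
  no_root : ∀ r : F, r ^ 2 - α * r + 1 ≠ 0
  exists_pow : ∀ x y : F, x ^ 2 + α * x * y + 1 * y ^ 2 = 1 →
    ∃ i : ℕ, ω ^ i = algebraMap F L x + algebraMap F L y * ω

lemma isNonsplitTrace_of_isPrimitiveRoot {p e : ℕ} [Fact p.Prime] [CharP F p]
    (hF : Fintype.card F = p ^ e) {L : Type*} [Field L] [Algebra F L] {ω : L}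
    (hω : IsPrimitiveRoot ω (Fintype.card F + 1)) : ∃ α : F, IsNonsplitTrace α ω := by
  have h0 : ω ≠ 0 := hω.ne_zero (by omega)
  have : CharP L p := charP_of_injective_algebraMap (algebraMap F L).injective p
  have hadd : ∀ x y : L, (x + y) ^ Fintype.card F = x ^ Fintype.card F + y ^ Fintype.card F := by
    intro x y
    rw [hF, add_pow_char_pow]
  have hωq : ω ^ Fintype.card F = ω⁻¹ := by
    refine eq_inv_of_mul_eq_one_left ?_
    rw [← pow_succ, hω.pow_eq_one]
  have hωq' : ω⁻¹ ^ Fintype.card F = ω := by rw [inv_pow, hωq, inv_inv]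
  obtain ⟨α, hα⟩ := exists_algebraMap_eq_of_pow_card_eq (F := F) (x := ω + ω⁻¹) (by
    rw [hadd, hωq, hωq', add_comm])
  have hF' : ∀ a : F, algebraMap F L a ^ Fintype.card F = algebraMap F L a := fun a ↦ by
    rw [← map_pow, FiniteField.pow_card]
  refine ⟨α, h0, hα.symm, fun i ↦ hω.pow_eq_one_iff_dvd i, fun r hr ↦ ?_, fun x y hxy ↦ ?_⟩
  · have h := congrArg (algebraMap F L) hr
    simp only [map_add, map_sub, map_mul, map_pow, map_one, map_zero, hα] at h
    have h2 : (algebraMap F L r - ω) * (algebraMap F L r - ω⁻¹) = 0 := by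
      linear_combination h + mul_inv_cancel₀ h0
    have h3 : ω⁻¹ = ω := by
      rcases mul_eq_zero.1 h2 with h4 | h4
      · rw [← hωq, ← sub_eq_zero.1 h4, hF']
      · have h5 := hF' r
        rw [sub_eq_zero.1 h4, hωq'] at h5
        exact h5.symm
    have h4 : ω ^ 2 = 1 := by
      nth_rewrite 1 [sq, ← h3]
      exact inv_mul_cancel₀ h0
    have := Nat.le_of_dvd (by norm_num) ((hω.pow_eq_one_iff_dvd 2).1 h4)
    have := Fintype.one_lt_card (α := F)
    omega
  · have h : (algebraMap F L x + algebraMap F L y * ω) ^ (Fintype.card F + 1) = 1 := by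
      rw [pow_succ, hadd, mul_pow, hF', hF', hωq]
      have := congrArg (algebraMap F L) hxy
      simp only [map_add, map_mul, map_pow, map_one, hα] at this
      linear_combination this + (algebraMap F L y) ^ 2 * mul_inv_cancel₀ h0
    obtain ⟨i, -, hi⟩ := hω.eq_pow_of_pow_eq_one h
    exact ⟨i, hi⟩

namespace IsNonsplitTrace

variable {L : Type*} [Field L] [Algebra F L] {α : F} {ω : L}

lemma pow_ne_one (h : IsNonsplitTrace α ω) (hq : 7 ≤ Fintype.card F) {n : ℕ} (hn : 0 < n)
    (hn8 : n < 8) : ω ^ n ≠ 1 := by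
  intro h1
  have := Nat.le_of_dvd hn ((h.pow_eq_one_iff n).1 h1)
  omega

lemma trace_ne (h : IsNonsplitTrace α ω) (hq : 7 ≤ Fintype.card F) :
    α ≠ 0 ∧ α ≠ 1 ∧ α ≠ -1 ∧ α ≠ 2 := by
  have h0 := h.ne_zero
  have hα := h.add_inv
  refine ⟨?_, ?_, ?_, ?_⟩ <;> rintro rfl <;>
    simp only [map_zero, map_one, map_neg, map_ofNat] at hα <;> field_simp at hα
  · apply h.pow_ne_one hq (n := 4) (by norm_num) (by norm_num)
    linear_combination (ω ^ 2 - 1) * hα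
  · apply h.pow_ne_one hq (n := 6) (by norm_num) (by norm_num)
    linear_combination (ω + 1) * (ω ^ 3 - 1) * hα
  · apply h.pow_ne_one hq (n := 3) (by norm_num) (by norm_num)
    linear_combination (ω - 1) * hα
  · apply h.pow_ne_one hq (n := 1) (by norm_num) (by norm_num)
    have : (ω - 1) ^ 2 = 0 := by linear_combination hα
    rw [pow_one]
    exact sub_eq_zero.1 (pow_eq_zero_iff two_ne_zero |>.1 this)

lemma sq_ne_one (h : IsNonsplitTrace α ω) (hq : 7 ≤ Fintype.card F) : ω ^ 2 ≠ 1 :=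
  h.pow_ne_one hq (by norm_num) (by norm_num)

lemma orderOf_mk (h : IsNonsplitTrace α ω) (hq : 7 ≤ Fintype.card F) {B : SL(2, F)}
    (hB : B 0 0 + B 1 1 = α) :
    orderOf (QuotientGroup.mk B : PSL2 F) =
      (Fintype.card F + 1) / Nat.gcd 2 (Fintype.card F + 1) :=
  orderOf_mk_eq h.ne_zero h.add_inv (by omega) (fun i ↦ h.pow_eq_one_iff (2 * i)) hB

end IsNonsplitTrace

lemma exists_isNonsplitTrace {p e : ℕ} [Fact p.Prime] [CharP F p]
    (hF : Fintype.card F = p ^ e) : ∃ (α : F) (ω : AlgebraicClosure F), IsNonsplitTrace α ω ∧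
      (Fintype.card F = 7 → α ^ 2 - α = -2) := by
  have hcast : (Fintype.card F : AlgebraicClosure F) = 0 := by
    rw [← map_natCast (algebraMap F (AlgebraicClosure F)), Nat.cast_card_eq_zero, map_zero]
  have : NeZero ((Fintype.card F + 1 : ℕ) : AlgebraicClosure F) := ⟨by simp [hcast]⟩
  obtain ⟨ω, hω⟩ :=
    HasEnoughRootsOfUnity.exists_primitiveRoot (AlgebraicClosure F) (Fintype.card F + 1)
  obtain ⟨α, hα⟩ := isNonsplitTrace_of_isPrimitiveRoot hF hω
  by_cases h7 : Fintype.card F = 7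
  · have h70 : (7 : F) = 0 := by
      have := Nat.cast_card_eq_zero F
      rw [h7] at this
      exact_mod_cast this
    have key : ∀ {α : F} {ω : AlgebraicClosure F}, IsNonsplitTrace α ω →
        α ^ 2 = 2 ∧ ω ^ 4 = -1 := by
      intro α ω h
      have h8 := (h.pow_eq_one_iff 8).2 (by rw [h7])
      have h4 := h.pow_ne_one (n := 4) (by omega) (by norm_num) (by norm_num)
      have h0 := h.ne_zero
      have h5 : ω ^ 4 = -1 := by
        have : (ω ^ 4 - 1) * (ω ^ 4 + 1) = 0 := by linear_combination h8
        exact eq_neg_of_add_eq_zero_left ((mul_eq_zero.1 this).resolve_left (sub_ne_zero.2 h4))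
      refine ⟨?_, h5⟩
      apply (algebraMap F (AlgebraicClosure F)).injective
      rw [map_pow, ← h.add_inv, map_ofNat]
      field_simp
      linear_combination h5
    obtain ⟨h2, h5⟩ := key hα
    by_cases h4 : α = 4
    · exact ⟨α, ω, hα, fun _ ↦ by rw [h2, h4]; ring⟩
    · have h3 : α = 3 := by
        have : (α - 4) * (α - 3) = 0 := by linear_combination h2 + (2 - α) * h70
        exact sub_eq_zero.1 ((mul_eq_zero.1 this).resolve_left (sub_ne_zero.2 h4))
      obtain ⟨α', hα'⟩ := isNonsplitTrace_of_isPrimitiveRoot hF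
        (hω.pow_of_coprime 5 (by rw [h7]; norm_num))
      refine ⟨α', ω ^ 5, hα', fun _ ↦ ?_⟩
      have h6 : algebraMap F (AlgebraicClosure F) α' = algebraMap F (AlgebraicClosure F) (-α) := by
        rw [map_neg, ← hα.add_inv, ← hα'.add_inv, show ω ^ 5 = -ω by linear_combination ω * h5,
          inv_neg]
        ring
      rw [(algebraMap F (AlgebraicClosure F)).injective h6, h3]
      linear_combination 2 * h70
  · exact ⟨α, ω, hα, fun h ↦ absurd h h7⟩

end NonsplitTrace

section DoubleCoset

variable {G : Type*} [Group G] [DecidableEq G]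

/-- The double coset of `g` with respect to a finite set `T`. -/
def doubleCosetFinset (T : Finset G) (g : G) : Finset G :=
  (T ×ˢ T).image fun st ↦ st.1 * g * st.2

lemma card_le_two_mul_card_doubleCosetFinset {T : Subgroup G} {Tf : Finset G}
    (hTf : ∀ x, x ∈ Tf ↔ x ∈ T) {c g : G}
    (hg : ∀ t ∈ T, ∀ t' ∈ T, t * g = g * t' → t = 1 ∨ t = c) :
    Tf.card * Tf.card ≤ 2 * (doubleCosetFinset Tf g).card := by
  rw [← Finset.card_product]
  refine Finset.card_le_mul_card_image _ _ fun b hb ↦ ?_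
  obtain ⟨⟨s, t⟩, hst, rfl⟩ := Finset.mem_image.1 hb
  rw [Finset.mem_product, hTf, hTf] at hst
  have hsub : ((Tf ×ˢ Tf).filter fun st ↦ st.1 * g * st.2 = s * g * t) ⊆
      {(s, t), (s * c, g⁻¹ * c⁻¹ * g * t)} := by
    rintro ⟨s', t'⟩ h
    rw [Finset.mem_filter, Finset.mem_product, hTf, hTf] at h
    obtain ⟨⟨hs', ht'⟩, h⟩ := h
    simp only at hs' ht' h
    have h1 : s⁻¹ * s' * g = g * (t * t'⁻¹) := by
      have h2 : s' * g = s * g * t * t'⁻¹ := by rw [← h]; group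
      rw [mul_assoc, h2]
      group
    have h2 : t' = g⁻¹ * (s⁻¹ * s')⁻¹ * g * t := by
      have h3 : t' = g⁻¹ * s'⁻¹ * (s * g * t) := by rw [← h]; group
      rw [h3]
      group
    have h3 : s' = s * (s⁻¹ * s') := by group
    rcases hg _ (T.mul_mem (T.inv_mem hst.1) hs') _ (T.mul_mem hst.2 (T.inv_mem ht')) h1 with
      h4 | h4
    · rw [h4] at h2 h3
      simp [h2, h3]
    · rw [h4] at h2 h3
      simp [h2, h3]
  exact (Finset.card_le_card hsub).trans Finset.card_le_two

lemma two_mul_card_doubleCosetFinset_le {T : Subgroup G} {Tf : Finset G}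
    (hTf : ∀ x, x ∈ Tf ↔ x ∈ T) {c g : G} (hcT : c ∈ T) (hc1 : c ≠ 1) (hcc : c * c = 1)
    (hcomm : ∀ g, c * g = g * c) :
    2 * (doubleCosetFinset Tf g).card ≤ Tf.card * Tf.card := by
  rw [← Finset.card_product]
  refine Finset.mul_card_image_le_card _ _ fun b hb ↦ ?_
  obtain ⟨⟨s, t⟩, hst, rfl⟩ := Finset.mem_image.1 hb
  rw [Finset.mem_product, hTf, hTf] at hst
  have hsub : ({(s, t), (s * c, c * t)} : Finset (G × G)) ⊆
      (Tf ×ˢ Tf).filter fun st ↦ st.1 * g * st.2 = s * g * t := by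
    intro x hx
    simp only [Finset.mem_insert, Finset.mem_singleton] at hx
    rw [Finset.mem_filter, Finset.mem_product, hTf, hTf]
    rcases hx with rfl | rfl
    · exact ⟨hst, rfl⟩
    · refine ⟨⟨T.mul_mem hst.1 hcT, T.mul_mem hcT hst.2⟩, ?_⟩
      calc s * c * g * (c * t) = s * (c * g) * c * t := by group
        _ = s * g * (c * c) * t := by rw [hcomm]; group
        _ = s * g * t := by rw [hcc, mul_one]
  have h2 : ({(s, t), (s * c, c * t)} : Finset (G × G)).card = 2 := by
    refine Finset.card_pair ?_
    intro h
    apply hc1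
    simpa using (congrArg Prod.fst h).symm
  rw [← h2]
  exact Finset.card_le_card hsub

/-- A subgroup `T` of even order, in which distinct conjugates by elements outside a small set `N`
meet in a fixed subgroup of order two, is not contained in subgroups of small order. -/
lemma false_of_card_dvd [Fintype G] {H T : Subgroup G} {N : Finset G} {c B : G} (hTH : T ≤ H) (hcT : c ∈ T)
    (hc1 : c ≠ 1) (hcc : c * c = 1) (hcomm : ∀ g, c * g = g * c)
    (hN : ∀ g ∉ N, ∀ t ∈ T, ∀ t' ∈ T, t * g = g * t' → t = 1 ∨ t = c)
    (hNinv : ∀ s ∈ T, ∀ t ∈ T, ∀ g ∉ N, s * g * t ∉ N) (hTN : ∀ t ∈ T, t ∈ N)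
    (hNcard : N.card ≤ 2 * Nat.card T) (hBH : B ∈ H) (hBN : B ∉ N) (hn : 8 < Nat.card T)
    (hdvd : Nat.card H ∣ Nat.card T * (Nat.card T - 2)) : False := by
  classical
  set Tf : Finset G := Finset.univ.filter (· ∈ T) with hTfdef
  have hTf : ∀ x, x ∈ Tf ↔ x ∈ T := by simp [hTfdef]
  set Hf : Finset G := Finset.univ.filter (· ∈ H) with hHfdef
  have hHf : ∀ x, x ∈ Hf ↔ x ∈ H := by simp [hHfdef]
  have hTc : Tf.card = Nat.card T := by
    rw [Nat.card_eq_fintype_card, Fintype.card_subtype]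
  have hHc : Hf.card = Nat.card H := by
    rw [Nat.card_eq_fintype_card, Fintype.card_subtype]
  set n := Nat.card T with hndef
  obtain ⟨m, hm⟩ := Subgroup.card_dvd_of_le hTH
  rw [hm] at hdvd
  obtain ⟨k, hk⟩ := Nat.dvd_of_mul_dvd_mul_left (by omega) hdvd
  have hDH : ∀ g ∈ H, doubleCosetFinset Tf g ⊆ Hf := by
    intro g hg x hx
    obtain ⟨⟨s, t⟩, hst, rfl⟩ := Finset.mem_image.1 hx
    rw [Finset.mem_product, hTf, hTf] at hst
    exact (hHf _).2 (H.mul_mem (H.mul_mem (hTH hst.1) hg) (hTH hst.2))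
  have hDN : ∀ g ∉ N, Disjoint Tf (doubleCosetFinset Tf g) := by
    intro g hg
    rw [Finset.disjoint_left]
    intro x hx hxD
    obtain ⟨⟨s, t⟩, hst, rfl⟩ := Finset.mem_image.1 hxD
    rw [Finset.mem_product, hTf, hTf] at hst
    exact hNinv _ hst.1 _ hst.2 _ hg (hTN _ ((hTf _).1 hx))
  have hTfH : Tf ⊆ Hf := fun x hx ↦ (hHf _).2 (hTH ((hTf _).1 hx))
  have hB1 := card_le_two_mul_card_doubleCosetFinset hTf (hN B hBN)
  have hB2 := two_mul_card_doubleCosetFinset_le hTf (g := B) hcT hc1 hcc hcomm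
  have hB3 : n + (doubleCosetFinset Tf B).card ≤ n * m := by
    rw [← hTc, ← Finset.card_union_of_disjoint (hDN B hBN), hTc, ← hm, ← hHc]
    exact Finset.card_le_card (Finset.union_subset hTfH (hDH B hBH))
  rw [hTc] at hB1 hB2
  have hk1 : k = 1 := by
    have hk0 : k ≠ 0 := by
      rintro rfl
      omega
    by_contra hk1
    have hk2 : 2 ≤ k := by omega
    have h2m : 2 * m ≤ n - 2 := by rw [hk]; nlinarith
    have h3 : 2 * m + 2 ≤ n := by omega
    nlinarith
  have hmn : m + 2 = n := by rw [hk1] at hk; omega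
  obtain ⟨g, hgH, hgN, hgD⟩ : ∃ g ∈ H, g ∉ N ∧ g ∉ doubleCosetFinset Tf B := by
    by_contra! hcon
    have hsub : Hf ⊆ N ∪ doubleCosetFinset Tf B := by
      intro x hx
      rw [Finset.mem_union]
      by_cases hxN : x ∈ N
      · exact Or.inl hxN
      · exact Or.inr (hcon x ((hHf x).1 hx) hxN)
    have h1 := (Finset.card_le_card hsub).trans (Finset.card_union_le _ _)
    rw [hHc, hm] at h1
    nlinarith
  have hg1 := card_le_two_mul_card_doubleCosetFinset hTf (hN g hgN)
  rw [hTc] at hg1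
  have hdisj : Disjoint (doubleCosetFinset Tf B) (doubleCosetFinset Tf g) := by
    rw [Finset.disjoint_left]
    intro x hxB hxg
    apply hgD
    obtain ⟨⟨s, t⟩, hst, rfl⟩ := Finset.mem_image.1 hxB
    obtain ⟨⟨s', t'⟩, hst', h⟩ := Finset.mem_image.1 hxg
    rw [Finset.mem_product, hTf, hTf] at hst hst'
    simp only at h hst hst'
    refine Finset.mem_image.2 ⟨(s'⁻¹ * s, t * t'⁻¹), ?_, ?_⟩
    · rw [Finset.mem_product, hTf, hTf]
      exact ⟨T.mul_mem (T.inv_mem hst'.1) hst.1, T.mul_mem hst.2 (T.inv_mem hst'.2)⟩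
    · calc s'⁻¹ * s * B * (t * t'⁻¹) = s'⁻¹ * (s * B * t) * t'⁻¹ := by group
        _ = g := by rw [← h]; group
  have h1 : (doubleCosetFinset Tf B).card + (doubleCosetFinset Tf g).card ≤ n * m := by
    rw [← Finset.card_union_of_disjoint hdisj, ← hm, ← hHc]
    exact Finset.card_le_card (Finset.union_subset (hDH B hBH) (hDH g hgH))
  nlinarith

end DoubleCoset

lemma exists_SL2_first_column {F : Type*} [Field F] (v w : F) (hvw : v ≠ 0 ∨ w ≠ 0) :
    ∃ M : SL(2, F), M 0 0 = v ∧ M 1 0 = w := by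
  by_cases hv : v = 0
  · have hw : w ≠ 0 := by simpa [hv] using hvw
    exact ⟨mkSL2 0 (-w⁻¹) w 0 (by field_simp; ring), by simp [hv], by simp⟩
  · exact ⟨mkSL2 v 0 w v⁻¹ (by field_simp; ring), by simp, by simp⟩

section NonsplitGeneration

variable {F : Type*} [Field F] [Fintype F] {L : Type*} [Field L] [Algebra F L] {α : F} {ω : L}

namespace IsNonsplitTrace

lemma norm_ne_zero (h : IsNonsplitTrace α ω) {x y : F} (hxy : x ≠ 0 ∨ y ≠ 0) :
    x ^ 2 + α * x * y + y ^ 2 ≠ 0 := by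
  intro h0
  by_cases hy : y = 0
  · simp [hy] at h0 hxy
    exact hxy h0
  · refine h.no_root (-x / y) ?_
    field_simp
    linear_combination h0

lemma sq_ne_four (h : IsNonsplitTrace α ω) (hq : 7 ≤ Fintype.card F) : α ^ 2 - 4 ≠ 0 := by
  have := disc_ne_zero h.ne_zero h.add_inv (h.sq_ne_one hq)
  rwa [mul_one] at this

lemma exists_companion_pow (h : IsNonsplitTrace α ω) (hq : 7 ≤ Fintype.card F) {u v : F}
    (huv : u ^ 2 + α * u * v + v ^ 2 = 1) :
    ∃ i : ℕ, (companionSL2 α ^ i) 0 0 = u ∧ (companionSL2 α ^ i) 0 1 = -v ∧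
      (companionSL2 α ^ i) 1 0 = v ∧ (companionSL2 α ^ i) 1 1 = u + v * α :=
  exists_companionSL2_pow h.ne_zero h.add_inv (h.sq_ne_one hq) h.exists_pow
    (by rwa [one_mul])

/-- The centraliser of a nonsplit element and a suitable unipotent element generate. -/
lemma eq_top_of_conj_upperUnip_mem (h : IsNonsplitTrace α ω) (hq : 7 ≤ Fintype.card F)
    (hq9 : Fintype.card F ≠ 9) {H : Subgroup SL(2, F)} (hA : companionSL2 α ∈ H) {M : SL(2, F)}
    {s : F} (hs : s ≠ 0) (hM : M * upperUnip s * M⁻¹ ∈ H)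
    (h2 : (2 : F) = 0 → s * (M 0 0 ^ 2 + α * M 0 0 * M 1 0 + M 1 0 ^ 2) ≠
      α * (M 0 0 * M 1 1 + M 0 1 * M 1 0)) : H = ⊤ := by
  have hd := SL2_det M
  obtain ⟨i1, i2, i3, i4⟩ := SL2_inv_apply M
  set a := M 0 0 with ha
  set b := M 0 1 with hb
  set c := M 1 0 with hc
  set d := M 1 1 with hdd
  have hac : a ≠ 0 ∨ c ≠ 0 := by
    by_contra! h0
    rw [h0.1, h0.2] at hd
    simp at hd
  have hN := h.norm_ne_zero hac
  set N := a ^ 2 + α * a * c + c ^ 2 with hNdef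
  set H' := H.comap (MulAut.conj M).toMonoidHom with hH'
  have hmem : ∀ g, g ∈ H' ↔ M * g * M⁻¹ ∈ H := fun g ↦ by
    simp [hH', Subgroup.mem_comap]
  have hform : ∀ x y : F, x ^ 2 + (2 * a * b + α * (a * d + b * c) + 2 * c * d) / N * x * y +
      (b ^ 2 + α * b * d + d ^ 2) / N * y ^ 2 =
      ((a * x + b * y) ^ 2 + α * (a * x + b * y) * (c * x + d * y) + (c * x + d * y) ^ 2) / N := by
    intro x y
    field_simp
    rw [hNdef]
    ring
  have hU : ∀ v, upperUnip v ∈ H' := by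
    refine upperUnip_mem_of_transitive (s := s)
      (β := (2 * a * b + α * (a * d + b * c) + 2 * c * d) / N)
      (γ := (b ^ 2 + α * b * d + d ^ 2) / N) ?_ ?_ hs ((hmem _).2 hM) ?_ ?_ hq hq9
    · intro h0
      apply h.sq_ne_four hq
      have h1 : (2 * a * b + α * (a * d + b * c) + 2 * c * d) ^ 2 -
          4 * (b ^ 2 + α * b * d + d ^ 2) * N = 0 := by
        field_simp at h0
        linear_combination h0
      rw [hNdef] at h1
      linear_combination h1 - (α ^ 2 - 4) * (a * d - b * c + 1) * hd
    · intro x y x' y' hQ hQ0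
      rw [hform, hform] at hQ
      rw [hform] at hQ0
      obtain ⟨g, hg, g1, g2⟩ := exists_mem_of_level_set_eq h.ne_zero h.add_inv (h.sq_ne_one hq)
        h.exists_pow hA (a * x + b * y) (c * x + d * y) (a * x' + b * y') (c * x' + d * y')
        (by
          field_simp at hQ
          linear_combination hQ)
        (by
          intro h0
          apply hQ0
          rw [one_mul] at h0
          rw [h0, zero_div])
      refine ⟨M⁻¹ * g * M, (hmem _).2 (by convert hg using 1; group), ?_, ?_⟩
      · simp only [SL2_mul_apply, i1, i2]
        linear_combination d * g1 - b * g2 + x' * hd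
      · simp only [SL2_mul_apply, i3, i4]
        linear_combination -c * g1 + a * g2 + y' * hd
    · intro h20 h0
      apply h2 h20
      rw [h0]
      field_simp
      linear_combination (a * b + c * d) * h20
    · intro g _
      rw [hform]
      refine div_ne_zero (h.norm_ne_zero ?_) hN
      by_contra! h0
      have hg := SL2_det g
      have e1 : g 0 0 = 0 := by linear_combination d * h0.1 - b * h0.2 - g 0 0 * hd
      have e2 : g 1 0 = 0 := by linear_combination a * h0.2 - c * h0.1 - g 1 0 * hd
      rw [e1, e2] at hg
      simp at hg
  have htop : H' = ⊤ := by
    refine eq_top_of_upperUnip_mem hU (g := M⁻¹ * companionSL2 α * M)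
      ((hmem _).2 (by convert hA using 1; group)) ?_
    simp only [SL2_mul_apply, i3, i4, companionSL2_00, companionSL2_01, companionSL2_10,
      companionSL2_11]
    intro h0
    apply hN
    rw [hNdef]
    linear_combination h0
  refine eq_top_iff.2 fun x _ ↦ ?_
  have := (hmem (M⁻¹ * x * M)).1 (htop ▸ Subgroup.mem_top _)
  convert this using 1
  group

/-- In odd characteristic, a nonsplit torus and any nontrivial element fixing a nonzero vector
generate. -/
lemma eq_top_of_fixes_vector (h : IsNonsplitTrace α ω) (hq : 7 ≤ Fintype.card F)
    (hq9 : Fintype.card F ≠ 9) (h2 : (2 : F) ≠ 0) {H : Subgroup SL(2, F)}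
    (hA : companionSL2 α ∈ H) {g : SL(2, F)} (hg : g ∈ H) (hg1 : g ≠ 1) {v w : F}
    (hvw : v ≠ 0 ∨ w ≠ 0) (e1 : g 0 0 * v + g 0 1 * w = v) (e2 : g 1 0 * v + g 1 1 * w = w) :
    H = ⊤ := by
  obtain ⟨M, rfl, rfl⟩ := exists_SL2_first_column v w hvw
  obtain ⟨i1, i2, i3, i4⟩ := SL2_inv_apply M
  have hd := SL2_det M
  have hgd := SL2_det g
  have key : M⁻¹ * g * M = upperUnip ((M⁻¹ * g * M) 0 1) := by
    have k00 : (M⁻¹ * g * M) 0 0 = 1 := by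
      simp only [SL2_mul_apply, i1, i2]
      linear_combination M 1 1 * e1 - M 0 1 * e2 + hd
    have k10 : (M⁻¹ * g * M) 1 0 = 0 := by
      simp only [SL2_mul_apply, i3, i4]
      linear_combination -M 1 0 * e1 + M 0 0 * e2
    refine SL2_ext k00 rfl k10 ?_
    have := SL2_det (M⁻¹ * g * M)
    rw [k00, k10] at this
    rw [upperUnip_11]
    linear_combination this
  have key2 : M * upperUnip ((M⁻¹ * g * M) 0 1) * M⁻¹ = g := by
    rw [← key]
    group
  refine h.eq_top_of_conj_upperUnip_mem hq hq9 hA (M := M) (s := (M⁻¹ * g * M) 0 1) ?_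
    (key2.symm ▸ hg) (fun h0 ↦ absurd h0 h2)
  intro h0
  rw [h0, upperUnip_zero] at key2
  apply hg1
  rw [← key2]
  group

lemma exists_char_two (h : IsNonsplitTrace α ω) (hq : 7 ≤ Fintype.card F)
    (hq9 : Fintype.card F ≠ 9) (h2 : (2 : F) = 0) : ∃ B : SL(2, F), B 0 0 + B 1 1 = α ∧
      (companionSL2 α * B) 0 0 + (companionSL2 α * B) 1 1 = α ∧
      ∀ H : Subgroup SL(2, F), companionSL2 α ∈ H → B ∈ H → H = ⊤ := by
  obtain ⟨hα0, hα1, -⟩ := h.trace_ne hq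
  have : CharP F 2 := CharTwo.of_one_ne_zero_of_two_eq_zero one_ne_zero h2
  obtain ⟨t, ht⟩ : ∃ t, α = t * t := FiniteField.isSquare_of_char_two
    (ringChar.eq F 2) _
  have ht0 : t ≠ 0 := by
    rintro rfl
    simp [ht] at hα0
  obtain ⟨r, hrt⟩ : ∃ r, r * t = 1 := ⟨t⁻¹, inv_mul_cancel₀ ht0⟩
  have hαr : α * r ^ 2 = 1 := by
    rw [ht]
    linear_combination (r * t + 1) * hrt
  have hB : (α - r) * r - (r + α + α * r) * r = 1 := by
    linear_combination -hαr - (r ^ 2 + 1) * h2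
  refine ⟨mkSL2 (α - r) (r + α + α * r) r r hB, by simp, ?_, fun H hA hB ↦ ?_⟩
  · simp only [SL2_mul_apply, companionSL2_00, companionSL2_01, companionSL2_10, companionSL2_11,
      mkSL2_00, mkSL2_01, mkSL2_10, mkSL2_11]
    linear_combination α * r * h2
  · obtain ⟨i, j1, j2, j3, j4⟩ := h.exists_companion_pow hq (u := r) (v := r) (by
      linear_combination hαr + r ^ 2 * h2)
    have hmem := H.mul_mem (H.pow_mem hA i) hB
    have hs : 1 + t ≠ 0 := by
      intro h0
      apply hα1
      rw [ht]
      linear_combination (t - 1) * h0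
    refine h.eq_top_of_conj_upperUnip_mem hq hq9 hA (M := mkSL2 1 0 1 1 (by ring)) hs ?_ ?_
    · convert hmem using 1
      obtain ⟨i1, i2, i3, i4⟩ := SL2_inv_apply (mkSL2 1 0 1 1 (by ring) : SL(2, F))
      refine SL2_ext ?_ ?_ ?_ ?_ <;>
        simp only [SL2_mul_apply, i1, i2, i3, i4, j1, j2, j3, j4, mkSL2_00, mkSL2_01, mkSL2_10,
          mkSL2_11, upperUnip_00, upperUnip_01, upperUnip_10, upperUnip_11] <;> rw [ht]
      · linear_combination -t * hrt + (r ^ 2 - t) * h2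
      · linear_combination -(t + r * t + 1) * hrt
      · linear_combination -(t + r * t + 1) * hrt - (1 + t) * h2
      · linear_combination -t * hrt + (1 - r ^ 2 - (r * t) ^ 2) * h2
    · intro _ h0
      simp only [mkSL2_00, mkSL2_01, mkSL2_10, mkSL2_11] at h0
      rw [ht] at h0
      refine pow_ne_zero 3 ht0 ?_
      linear_combination h0 - (1 + t) * h2

end IsNonsplitTrace

end NonsplitGeneration

section OddNonsplit

variable {F : Type*} [Field F] {α : F}

lemma companionSL2_mul_comm_iff (g : SL(2, F)) :
    companionSL2 α * g = g * companionSL2 α ↔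
      g 0 1 = -g 1 0 ∧ g 1 1 = g 0 0 + α * g 1 0 := by
  constructor
  · intro h
    have h1 := congrArg (fun x : SL(2, F) ↦ x 0 0) h
    have h2 := congrArg (fun x : SL(2, F) ↦ x 1 0) h
    simp only [SL2_mul_apply, companionSL2_00, companionSL2_01, companionSL2_10,
      companionSL2_11] at h1 h2
    exact ⟨by linear_combination -h1, by linear_combination -h2⟩
  · rintro ⟨h1, h2⟩
    refine SL2_ext ?_ ?_ ?_ ?_ <;>
      simp only [SL2_mul_apply, companionSL2_00, companionSL2_01, companionSL2_10,
        companionSL2_11, h1, h2] <;> ring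

lemma companionSL2_mul_eq_mul_inv_iff (g : SL(2, F)) :
    companionSL2 α * g = g * (companionSL2 α)⁻¹ ↔
      g 0 1 = g 1 0 + α * g 0 0 ∧ g 1 1 = -g 0 0 := by
  obtain ⟨i1, i2, i3, i4⟩ := SL2_inv_apply (companionSL2 α)
  constructor
  · intro h
    have h1 := congrArg (fun x : SL(2, F) ↦ x 0 0) h
    have h2 := congrArg (fun x : SL(2, F) ↦ x 0 1) h
    simp only [SL2_mul_apply, i1, i2, i3, i4, companionSL2_00, companionSL2_01, companionSL2_10,
      companionSL2_11] at h1 h2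
    exact ⟨by linear_combination h1, by linear_combination -h2⟩
  · rintro ⟨h1, h2⟩
    refine SL2_ext ?_ ?_ ?_ ?_ <;>
      simp only [SL2_mul_apply, i1, i2, i3, i4, companionSL2_00, companionSL2_01,
        companionSL2_10, companionSL2_11, h1, h2] <;> ring

/-- Elements of the centraliser of `companionSL2 α` are conjugate only via its normaliser. -/
lemma eq_scalar_of_mul_eq_mul (h2 : (2 : F) ≠ 0) (h4 : α ^ 2 - 4 ≠ 0) {g t t' : SL(2, F)}
    (ht : companionSL2 α * t = t * companionSL2 α)
    (ht' : companionSL2 α * t' = t' * companionSL2 α) (htg : t * g = g * t')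
    (hg1 : companionSL2 α * g ≠ g * companionSL2 α)
    (hg2 : companionSL2 α * g ≠ g * (companionSL2 α)⁻¹) :
    t = 1 ∨ t = mkSL2 (-1) 0 0 (-1) (by ring) := by
  obtain ⟨a1, a2⟩ := (companionSL2_mul_comm_iff t).1 ht
  obtain ⟨b1, b2⟩ := (companionSL2_mul_comm_iff t').1 ht'
  have d1 := SL2_det t
  have d2 := SL2_det t'
  have dg := SL2_det g
  have e1 := congrArg (fun x : SL(2, F) ↦ x 0 0) htg
  have e2 := congrArg (fun x : SL(2, F) ↦ x 0 1) htg
  have e3 := congrArg (fun x : SL(2, F) ↦ x 1 0) htg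
  have e4 := congrArg (fun x : SL(2, F) ↦ x 1 1) htg
  simp only [SL2_mul_apply, a1, a2, b1, b2] at e1 e2 e3 e4
  rw [a1, a2] at d1
  rw [b1, b2] at d2
  have htr : 2 * t 0 0 + α * t 1 0 = 2 * t' 0 0 + α * t' 1 0 := by
    linear_combination g 1 1 * e1 - g 1 0 * e2 - g 0 1 * e3 + g 0 0 * e4 -
      (2 * t 0 0 + α * t 1 0 - 2 * t' 0 0 - α * t' 1 0) * dg
  have hsq : (t 1 0 - t' 1 0) * (t 1 0 + t' 1 0) = 0 := by
    refine (mul_eq_zero.1 (?_ : (α ^ 2 - 4) * _ = 0)).resolve_left h4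
    linear_combination (2 * t 0 0 + α * t 1 0 + 2 * t' 0 0 + α * t' 1 0) * htr - 4 * d1 + 4 * d2
  by_cases hy : t 1 0 = 0
  · rw [hy] at d1 a1 a2
    have h3 : (t 0 0 - 1) * (t 0 0 + 1) = 0 := by linear_combination d1
    rcases mul_eq_zero.1 h3 with h3 | h3
    · have h3 : t 0 0 = 1 := by linear_combination h3
      left
      refine SL2_ext ?_ ?_ ?_ ?_ <;> simp [a1, a2, hy, h3]
    · have h3 : t 0 0 = -1 := by linear_combination h3
      right
      refine SL2_ext ?_ ?_ ?_ ?_ <;> simp [a1, a2, hy, h3]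
  exfalso
  rcases mul_eq_zero.1 hsq with h5 | h5
  · have h6 : t' 1 0 = t 1 0 := by linear_combination -h5
    rw [h6] at htr e1 e2 e3 e4
    have h7 : t' 0 0 = t 0 0 := mul_left_cancel₀ h2 (by linear_combination -htr)
    rw [h7] at e1 e2 e3 e4
    refine hg1 ((companionSL2_mul_comm_iff g).2 ⟨mul_left_cancel₀ hy ?_, mul_left_cancel₀ hy ?_⟩)
    · linear_combination -e1
    · linear_combination -e3
  · have h6 : t' 1 0 = -t 1 0 := by linear_combination h5
    rw [h6] at htr e1 e2 e3 e4
    have h7 : t' 0 0 = t 0 0 + α * t 1 0 := mul_left_cancel₀ h2 (by linear_combination -htr)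
    rw [h7] at e1 e2 e3 e4
    refine hg2 ((companionSL2_mul_eq_mul_inv_iff g).2
      ⟨mul_left_cancel₀ hy ?_, mul_left_cancel₀ hy ?_⟩)
    · linear_combination e1
    · linear_combination -e2

lemma not_commute_of_trace (h2 : (2 : F) ≠ 0) (h4 : α ^ 2 - 4 ≠ 0) (h1 : α ≠ -1)
    {B : SL(2, F)} (hB : B 0 0 + B 1 1 = α)
    (hAB : (companionSL2 α * B) 0 0 + (companionSL2 α * B) 1 1 = α) :
    companionSL2 α * B ≠ B * companionSL2 α := by
  intro h
  obtain ⟨a1, a2⟩ := (companionSL2_mul_comm_iff B).1 h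
  have hd := SL2_det B
  simp only [SL2_mul_apply, companionSL2_00, companionSL2_01, companionSL2_10,
    companionSL2_11, a1, a2] at hAB
  rw [a2] at hB
  rw [a1, a2] at hd
  have hp : α + 2 ≠ 0 := fun h0 ↦ h4 (by linear_combination (α - 2) * h0)
  have hm : α - 2 ≠ 0 := fun h0 ↦ h4 (by linear_combination (α + 2) * h0)
  have e1 : (α + 2) * B 1 0 = -α := by
    refine mul_left_cancel₀ hm ?_
    linear_combination 2 * hAB - α * hB
  have e2 : B 0 0 = -(α + 1) * B 1 0 := by
    refine mul_left_cancel₀ h2 ?_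
    linear_combination hB + e1
  rw [e2] at hd
  refine h1 (sub_eq_zero.1 (mul_left_cancel₀ hm ?_))
  linear_combination -((α + 2) * B 1 0 - α) * e1 + (α + 2) * hd

variable [Fintype F] {L : Type*} [Field L] [Algebra F L] {ω : L}

lemma exists_trace_eq (h2 : (2 : F) ≠ 0) (h4 : α ^ 2 - 4 ≠ 0) :
    ∃ B : SL(2, F), B 0 0 + B 1 1 = α ∧
      (companionSL2 α * B) 0 0 + (companionSL2 α * B) 1 1 = α := by
  have hp : α + 2 ≠ 0 := fun h0 ↦ h4 (by linear_combination (α - 2) * h0)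
  have hm : α - 2 ≠ 0 := fun h0 ↦ h4 (by linear_combination (α + 2) * h0)
  have h4' : (4 : F) ≠ 0 := by
    intro h
    apply h2
    refine pow_eq_zero_iff two_ne_zero |>.1 ?_
    linear_combination h
  have hodd : Fintype.card F % 2 = 1 := FiniteField.odd_card_of_char_ne_two fun h ↦ by
    have : CharP F 2 := ringChar.of_eq h
    exact h2 (CharTwo.two_eq_zero)
  obtain ⟨z', d, h⟩ := FiniteField.exists_root_sum_quadratic
    (f := Polynomial.C (α - 2) * Polynomial.X ^ 2 + Polynomial.C 0 * Polynomial.X +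
      Polynomial.C 0)
    (g := Polynomial.C (-(α + 2) / 4) * Polynomial.X ^ 2 + Polynomial.C α * Polynomial.X +
      Polynomial.C (-1))
    (Polynomial.degree_quadratic hm)
    (Polynomial.degree_quadratic (div_ne_zero (neg_ne_zero.2 hp) h4')) hodd
  simp only [Polynomial.eval_add, Polynomial.eval_mul, Polynomial.eval_C, Polynomial.eval_pow,
    Polynomial.eval_X] at h
  obtain ⟨z, hz⟩ : ∃ z, z' = z + d / 2 := ⟨z' - d / 2, by ring⟩
  have hdet : (α - (z + d)) * (z + d) - (z + α - α * (z + d)) * z = 1 := by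
    rw [hz] at h
    field_simp at h
    refine mul_left_cancel₀ (mul_ne_zero h4' h4') ?_
    linear_combination h
  refine ⟨mkSL2 (α - (z + d)) (z + α - α * (z + d)) z (z + d) hdet, by simp, ?_⟩
  simp only [SL2_mul_apply, companionSL2_00, companionSL2_01, companionSL2_10,
    companionSL2_11, mkSL2_00, mkSL2_01, mkSL2_10, mkSL2_11]
  ring

/-- A subgroup of `SL(2, F)` acting freely on the nonzero vectors has order dividing `|F|² - 1`. -/
lemma card_dvd_of_free (H : Subgroup SL(2, F))
    (hfree : ∀ g ∈ H, ∀ v w : F, (v ≠ 0 ∨ w ≠ 0) → g 0 0 * v + g 0 1 * w = v →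
      g 1 0 * v + g 1 1 * w = w → g = 1) :
    Nat.card H ∣ (Fintype.card F + 1) * (Fintype.card F - 1) := by
  classical
  let X := {v : Fin 2 → F // v ≠ 0}
  let act : MulAction H X :=
    { smul := fun g v ↦ ⟨g.1.1 *ᵥ v.1, fun h0 ↦ v.2 (by
        have := congrArg (fun x ↦ (g.1⁻¹).1 *ᵥ x) h0
        have hg : (g.1⁻¹).1 * g.1.1 = 1 := congrArg Subtype.val (inv_mul_cancel g.1)
        rw [mulVec_mulVec, hg, one_mulVec, mulVec_zero] at this
        exact this)⟩
      one_smul := fun v ↦ Subtype.ext (one_mulVec v.1)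
      mul_smul := fun g h v ↦ Subtype.ext (mulVec_mulVec v.1 g.1.1 h.1.1).symm }
  have hstab : ∀ v : X, MulAction.stabilizer H v = ⊥ := by
    intro v
    refine (Subgroup.eq_bot_iff_forall _).2 fun g hg ↦ ?_
    have h1 : g.1.1 *ᵥ v.1 = v.1 := congrArg Subtype.val (MulAction.mem_stabilizer_iff.1 hg)
    have h2 := congrFun h1 0
    have h3 := congrFun h1 1
    simp only [mulVec, dotProduct, Fin.sum_univ_two] at h2 h3
    refine Subtype.ext (hfree g.1 g.2 (v.1 0) (v.1 1) ?_ h2 h3)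
    by_contra! h0
    refine v.2 (funext fun i ↦ ?_)
    fin_cases i
    · exact h0.1
    · exact h0.2
  have hcard := Nat.card_congr (MulAction.selfEquivOrbitsQuotientProd hstab)
  have hX : Nat.card X = (Fintype.card F + 1) * (Fintype.card F - 1) := by
    rw [Nat.card_eq_fintype_card, Fintype.card_subtype_compl, Fintype.card_subtype_eq,
      Fintype.card_pi, Fin.prod_univ_two, ← sq, ← Nat.sq_sub_sq, one_pow]
  rw [← hX, hcard, Nat.card_prod]
  exact dvd_mul_left _ _

namespace IsNonsplitTrace

lemma orderOf_companionSL2 (h : IsNonsplitTrace α ω) (hq : 7 ≤ Fintype.card F) :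
    orderOf (companionSL2 α) = Fintype.card F + 1 := by
  refine (Nat.dvd_right_iff_eq).1 fun i ↦ ?_
  rw [orderOf_dvd_iff_pow_eq_one, ← h.pow_eq_one_iff]
  obtain ⟨x, y, e1, e2, e3, e4, e5⟩ := exists_pow_coeff (L := L)
    (B := companionSL2 α) (α := α) (by simp) i
  obtain ⟨s1, s2⟩ := sq_eq_of_add_inv h.ne_zero h.add_inv
  have f1 := e5 _ s1
  have f2 := e5 _ s2
  simp only [companionSL2_00, companionSL2_01, companionSL2_10, companionSL2_11] at e1 e2 e3 e4
  constructor
  · intro hi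
    rw [hi] at e1 e3
    have hy : y = 0 := by simpa using e3.symm
    have hx : x = 1 := by simpa using e1.symm
    rw [f1, hx, hy]
    simp
  · intro hi
    have hi' : ω⁻¹ ^ i = 1 := by rw [inv_pow, hi, inv_one]
    have h0 : algebraMap F L y * (ω - ω⁻¹) = 0 := by linear_combination hi - hi' - f1 + f2
    have hy : y = 0 := by
      simpa using (mul_eq_zero.1 h0).resolve_right
        (sub_inv_ne_zero h.ne_zero (h.sq_ne_one hq))
    have hx : x = 1 := by
      have : algebraMap F L x = algebraMap F L 1 := by
        rw [map_one, ← hi, f1, hy]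
        simp
      exact (algebraMap F L).injective this
    subst hx hy
    refine SL2_ext ?_ ?_ ?_ ?_ <;> simp [e1, e2, e3, e4]

lemma mem_zpowers_iff (h : IsNonsplitTrace α ω) (hq : 7 ≤ Fintype.card F) (g : SL(2, F)) :
    g ∈ Subgroup.zpowers (companionSL2 α) ↔ companionSL2 α * g = g * companionSL2 α := by
  constructor
  · rintro ⟨i, rfl⟩
    exact ((Commute.refl _).zpow_right i).eq
  · intro hg
    obtain ⟨h1, h2⟩ := (companionSL2_mul_comm_iff g).1 hg
    have hd := SL2_det g
    rw [h1, h2] at hd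
    obtain ⟨i, e1, e2, e3, e4⟩ := h.exists_companion_pow hq (u := g 0 0) (v := g 1 0)
      (by linear_combination hd)
    refine ⟨i, (zpow_natCast _ _).trans ?_⟩
    refine SL2_ext e1 (by rw [e2, h1]) e3 (by rw [e4, h2]; ring)

lemma exists_fixes_vector (h : IsNonsplitTrace α ω) (hq : 8 ≤ Fintype.card F) (h2 : (2 : F) ≠ 0)
    {B : SL(2, F)} (hB : B 0 0 + B 1 1 = α)
    (hAB : (companionSL2 α * B) 0 0 + (companionSL2 α * B) 1 1 = α) {H : Subgroup SL(2, F)}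
    (hAH : companionSL2 α ∈ H) (hBH : B ∈ H) :
    ∃ g ∈ H, g ≠ 1 ∧ ∃ v w : F, (v ≠ 0 ∨ w ≠ 0) ∧ g 0 0 * v + g 0 1 * w = v ∧
      g 1 0 * v + g 1 1 * w = w := by
  classical
  by_contra! hcon
  have hdvd := card_dvd_of_free H fun g hg v w hvw e1 e2 ↦ by
    by_contra hg1
    exact hcon g hg hg1 v w hvw e1 e2
  have hq7 : 7 ≤ Fintype.card F := by omega
  have h4 := h.sq_ne_four hq7
  obtain ⟨hα0, -, hα1, -⟩ := h.trace_ne hq7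
  have : Fintype SL(2, F) := Fintype.ofFinite _
  set A := companionSL2 α with hA
  set T := Subgroup.zpowers A with hT
  have hTmem : ∀ g, g ∈ T ↔ A * g = g * A := h.mem_zpowers_iff hq7
  have hTcard : Nat.card T = Fintype.card F + 1 := by
    rw [hT, Nat.card_zpowers, h.orderOf_companionSL2 hq7]
  set N1 : Finset SL(2, F) := Finset.univ.filter fun g ↦ A * g = g * A with hN1
  set N2 : Finset SL(2, F) := Finset.univ.filter fun g ↦ A * g = g * A⁻¹ with hN2
  have hN1card : N1.card = Nat.card T := by
    rw [Nat.card_eq_fintype_card, Fintype.card_subtype]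
    congr 1
    ext g
    simp [hN1, hTmem]
  have hN2card : N2.card ≤ Nat.card T := by
    rcases N2.eq_empty_or_nonempty with h0 | ⟨g, hg⟩
    · simp [h0]
    · rw [← hN1card]
      refine Finset.card_le_card_of_injOn (fun x ↦ x * g⁻¹) ?_ ?_
      · intro x hx
        simp only [hN1, hN2, Finset.coe_filter, Finset.mem_filter, Finset.mem_univ, true_and,
          Set.mem_ofPred_eq] at hx hg ⊢
        have : A⁻¹ * g⁻¹ = g⁻¹ * A := by
          have := congrArg (fun y ↦ y⁻¹) hg
          simp only [_root_.mul_inv_rev, inv_inv] at this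
          calc A⁻¹ * g⁻¹ = A⁻¹ * (A * g⁻¹) * A := by rw [← this]; group
            _ = g⁻¹ * A := by group
        rw [← mul_assoc, hx, mul_assoc, this, mul_assoc]
      · intro x _ y _ hxy
        exact mul_right_cancel hxy
  have hc : ∀ g : SL(2, F), mkSL2 (-1) 0 0 (-1) (by ring) * g =
      g * mkSL2 (-1) 0 0 (-1) (by ring) := by
    intro g
    refine SL2_ext ?_ ?_ ?_ ?_ <;> simp [SL2_mul_apply]
  have hNmem : ∀ g, g ∈ N1 ∪ N2 ↔ (A * g = g * A ∨ A * g = g * A⁻¹) := by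
    simp [hN1, hN2]
  refine false_of_card_dvd (H := H) (T := T) (N := N1 ∪ N2) (B := B)
    (c := mkSL2 (-1) 0 0 (-1) (by ring)) ?_ ?_ ?_ ?_ hc ?_ ?_ ?_ ?_ hBH ?_ ?_ ?_
  · rwa [hT, Subgroup.zpowers_le]
  · exact (hTmem _).2 (hc A).symm
  · intro h0
    have := congrArg (fun x : SL(2, F) ↦ x 0 0) h0
    simp at this
    apply h2
    linear_combination -this
  · refine SL2_ext ?_ ?_ ?_ ?_ <;> simp [SL2_mul_apply]
  · intro g hg t ht t' ht' htg
    rw [hNmem, not_or] at hg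
    exact eq_scalar_of_mul_eq_mul h2 h4 ((hTmem _).1 ht) ((hTmem _).1 ht') htg hg.1 hg.2
  · intro s hs t ht g hg
    rw [hNmem, not_or] at hg ⊢
    have hs1 := (hTmem s).1 hs
    have ht1 := (hTmem t).1 ht
    have ht2 : t * A⁻¹ = A⁻¹ * t := by
      calc t * A⁻¹ = A⁻¹ * (A * t) * A⁻¹ := by group
        _ = A⁻¹ * t := by rw [ht1]; group
    have key : A * (s * g * t) = s * (A * g) * t := by
      rw [← mul_assoc, ← mul_assoc, hs1]
      group
    constructor
    · intro h0
      refine hg.1 (mul_left_cancel (a := s) (mul_right_cancel (b := t) ?_))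
      rw [← key, h0, mul_assoc _ t, ← ht1]
      group
    · intro h0
      refine hg.2 (mul_left_cancel (a := s) (mul_right_cancel (b := t) ?_))
      rw [← key, h0, mul_assoc _ t, ht2]
      group
  · intro t ht
    exact (hNmem t).2 (Or.inl ((hTmem t).1 ht))
  · calc (N1 ∪ N2).card ≤ N1.card + N2.card := Finset.card_union_le _ _
      _ ≤ 2 * Nat.card T := by omega
  · rw [hNmem, not_or]
    refine ⟨not_commute_of_trace h2 h4 hα1 hB hAB, fun h0 ↦ hα0 ?_⟩
    obtain ⟨-, h1⟩ := (companionSL2_mul_eq_mul_inv_iff B).1 h0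
    rw [← hB, h1]
    ring
  · omega
  · rw [hTcard]
    exact hdvd

lemma exists_fixes_vector_of_card_eq_seven (h : IsNonsplitTrace α ω) (hq : 7 ≤ Fintype.card F)
    (h2 : (2 : F) ≠ 0) (hα : α ^ 2 - α = -2) {B : SL(2, F)} (hB : B 0 0 + B 1 1 = α)
    (hAB : (companionSL2 α * B) 0 0 + (companionSL2 α * B) 1 1 = α) {H : Subgroup SL(2, F)}
    (hAH : companionSL2 α ∈ H) (hBH : B ∈ H) :
    ∃ g ∈ H, g ≠ 1 ∧ ∃ v w : F, (v ≠ 0 ∨ w ≠ 0) ∧ g 0 0 * v + g 0 1 * w = v ∧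
      g 1 0 * v + g 1 1 * w = w := by
  obtain ⟨i, e1, e2, e3, e4⟩ := h.exists_companion_pow hq (u := -1) (v := 0) (by ring)
  obtain ⟨hα0, -⟩ := h.trace_ne hq
  set C := companionSL2 α * B with hC
  have hg := H.mul_mem (H.pow_mem hAH i) (H.mul_mem hAH (H.mul_mem hAH hBH))
  rw [← hC] at hg
  set g := companionSL2 α ^ i * (companionSL2 α * C) with hgdef
  have g00 : g 0 0 = C 1 0 := by simp [hgdef, SL2_mul_apply, e1, e2]
  have g01 : g 0 1 = C 1 1 := by simp [hgdef, SL2_mul_apply, e1, e2]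
  have g10 : g 1 0 = -C 0 0 - α * C 1 0 := by
    simp [hgdef, SL2_mul_apply, e3, e4]
    ring
  have g11 : g 1 1 = -C 0 1 - α * C 1 1 := by
    simp [hgdef, SL2_mul_apply, e3, e4]
    ring
  have htr : g 0 0 + g 1 1 = 2 := by
    have hBC : C 0 1 = -B 1 1 ∧ C 1 0 = B 0 0 + α * B 1 0 ∧ C 0 0 = -B 1 0 := by
      simp [hC, SL2_mul_apply]
    rw [g00, g11, hBC.1, hBC.2.1]
    rw [hBC.2.2] at hAB
    linear_combination hB - α * hAB - hα
  have hd := SL2_det g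
  refine ⟨g, hg, ?_, ?_⟩
  · intro h1
    rw [h1] at g00 g01 g10 g11
    change (1 : F) = _ at g00
    change (0 : F) = _ at g01 g10
    refine hα0 ((mul_eq_zero.1 (?_ : 2 * α = 0)).resolve_left h2)
    linear_combination -hAB + g10 + α * g00 - g01
  · by_cases h0 : g 0 1 = 0
    · rw [h0] at hd
      refine ⟨0, 1, by simp, by simp [h0], ?_⟩
      have : (g 1 1 - 1) ^ 2 = 0 := by linear_combination g 1 1 * htr - hd
      have := pow_eq_zero_iff two_ne_zero |>.1 this
      linear_combination this
    · refine ⟨g 0 1, 1 - g 0 0, Or.inl h0, by ring, ?_⟩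
      linear_combination htr - hd

end IsNonsplitTrace

/-- Triples of elements of nonsplit tori generating `SL(2, F)`. -/
lemma exists_nonsplit_triple {p e : ℕ} [Fact p.Prime] [CharP F p]
    (hF : Fintype.card F = p ^ e) (hq : 7 ≤ Fintype.card F) (hq9 : Fintype.card F ≠ 9) :
    ∃ (α : F) (A B C : SL(2, F)), A * B * C = 1 ∧ A 0 0 + A 1 1 = α ∧ B 0 0 + B 1 1 = α ∧
      C 0 0 + C 1 1 = α ∧ (∀ r, r ^ 2 - α * r + 1 ≠ 0) ∧
      (∀ H : Subgroup SL(2, F), A ∈ H → B ∈ H → H = ⊤) ∧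
      ∀ g : SL(2, F), g 0 0 + g 1 1 = α → orderOf (QuotientGroup.mk g : PSL2 F) =
        (Fintype.card F + 1) / Nat.gcd 2 (Fintype.card F + 1) := by
  obtain ⟨α, ω, h, h7⟩ := exists_isNonsplitTrace (F := F) hF
  obtain ⟨B, hB, hAB, hgen⟩ : ∃ B : SL(2, F), B 0 0 + B 1 1 = α ∧
      (companionSL2 α * B) 0 0 + (companionSL2 α * B) 1 1 = α ∧
      ∀ H : Subgroup SL(2, F), companionSL2 α ∈ H → B ∈ H → H = ⊤ := by
    by_cases h2 : (2 : F) = 0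
    · exact h.exists_char_two hq hq9 h2
    · obtain ⟨B, hB, hAB⟩ := exists_trace_eq h2 (h.sq_ne_four hq)
      refine ⟨B, hB, hAB, fun H hAH hBH ↦ ?_⟩
      obtain ⟨g, hg, hg1, v, w, hvw, e1, e2⟩ : ∃ g ∈ H, g ≠ 1 ∧ ∃ v w : F, (v ≠ 0 ∨ w ≠ 0) ∧
          g 0 0 * v + g 0 1 * w = v ∧ g 1 0 * v + g 1 1 * w = w := by
        by_cases hc : Fintype.card F = 7
        · exact h.exists_fixes_vector_of_card_eq_seven hq h2 (h7 hc) hB hAB hAH hBH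
        · exact h.exists_fixes_vector (by omega) h2 hB hAB hAH hBH
      exact h.eq_top_of_fixes_vector hq hq9 h2 hAH hg hg1 hvw e1 e2
  obtain ⟨i1, i2, i3, i4⟩ := SL2_inv_apply (companionSL2 α * B)
  exact ⟨α, companionSL2 α, B, (companionSL2 α * B)⁻¹, mul_inv_cancel _, by simp, hB,
    by rw [i1, i4, add_comm, hAB], h.no_root, hgen, fun g hg ↦ h.orderOf_mk hq hg⟩

end OddNonsplit

/-- Let `q = p ^ e ≥ 7` be a prime power with `q ≠ 9`, and
`d = gcd(2, q - 1)`.  Then `PSL₂(q)` admits an unmixed Beauville structure of type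
`(((q-1)/d, (q-1)/d, p), ((q+1)/d, (q+1)/d, (q+1)/d))`. -/
theorem beauville_type_split_p_nonsplit_PSL2 (p e : ℕ) (hp : p.Prime) (he : 0 < e)
    (hq : 7 ≤ p ^ e) (hq9 : p ^ e ≠ 9)
    (F : Type*) [Field F] [Fintype F] (hF : Fintype.card F = p ^ e) :
    HasBeauvilleOfType (PSL2 F)
      ((p ^ e - 1) / Nat.gcd 2 (p ^ e - 1)) ((p ^ e - 1) / Nat.gcd 2 (p ^ e - 1)) p
      ((p ^ e + 1) / Nat.gcd 2 (p ^ e - 1)) ((p ^ e + 1) / Nat.gcd 2 (p ^ e - 1))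
      ((p ^ e + 1) / Nat.gcd 2 (p ^ e - 1)) := by
  have : Fact p.Prime := ⟨hp⟩
  have : CharP F p := by
    obtain ⟨r, hr⟩ := CharP.exists F
    obtain ⟨n, hr', hn⟩ := FiniteField.card F r
    rw [hF] at hn
    have hpr : p = r := by
      have h1 : p ∣ r ^ (n : ℕ) := hn ▸ dvd_pow_self p he.ne'
      exact (Nat.prime_dvd_prime_iff_eq hp hr').1 (hp.dvd_of_dvd_pow h1)
    rwa [hpr]
  rw [← hF] at hq hq9 ⊢
  have hgcd : Nat.gcd 2 (Fintype.card F - 1) = Nat.gcd 2 (Fintype.card F + 1) := by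
    rw [show Fintype.card F + 1 = Fintype.card F - 1 + 2 by omega, Nat.gcd_add_self_right]
  obtain ⟨a, b, c, habc, ha, hb, hc, htop, hoa, hob, hoc⟩ := exists_split_triple (F := F) p hq hq9
  obtain ⟨α, A, B, C, hABC, hA, hB, hC, hα, htop', ho⟩ := exists_nonsplit_triple hF hq hq9
  rw [← hgcd] at ho
  refine ⟨QuotientGroup.mk a, QuotientGroup.mk b, QuotientGroup.mk c, QuotientGroup.mk A,
    QuotientGroup.mk B, QuotientGroup.mk C, ⟨?_, ?_, closure_mk_eq_top htop,
      closure_mk_eq_top htop', sigma3_inter_eq_one ha hb hc hA hB hC hα⟩,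
    hoa, hob, hoc, ho A hA, ho B hB, ho C hC⟩
  · rw [← QuotientGroup.mk_mul, ← QuotientGroup.mk_mul, habc, QuotientGroup.mk_one]
  · rw [← QuotientGroup.mk_mul, ← QuotientGroup.mk_mul, hABC, QuotientGroup.mk_one]
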